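/- There exist absolute constants C, c > 0 such that the following holds. Let p be a prime with p ≡ 3 (mod 4) and let E ⊆ F_p² with |E| ≤ c·p^{8/5}. Then either |Δ(E)| ≥ C·|E|^{12/19}, or |Δ(E)|^{19}·□(E)^{4} ≥ C·|E|^{20}. -/

import Mathlib

open Finset

namespace FpDist

/-- Points of `𝔽_p²`. -/
abbrev Pt (p : ℕ) := ZMod p × ZMod p

/-- The "distance" `‖x - y‖ = (x₁-y₁)² + (x₂-y₂)²` in `𝔽_p²`. -/
def dist2 {p : ℕ} (x y : Pt p) : ZMod p := (x.1 - y.1)^2 + (x.2 - y.2)^2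

/-- `‖x‖ = x₁² + x₂²`. -/
def norm2 {p : ℕ} (x : Pt p) : ZMod p := x.1^2 + x.2^2

/-- The distance set `Δ(E) = {‖x - y‖ : x, y ∈ E}`. -/
def distSet {p : ℕ} (E : Finset (Pt p)) : Finset (ZMod p) :=
  (E ×ˢ E).image fun q => dist2 q.1 q.2

/-- `(a, b, c)` is a corner if `(b - a) · (c - a) = 0`. -/
def IsCorner {p : ℕ} (a b c : Pt p) : Prop :=
  (b.1 - a.1) * (c.1 - a.1) + (b.2 - a.2) * (c.2 - a.2) = 0

/-- `(a, b, c, d)` forms a rectangle if `(a,b,d), (b,a,c), (c,b,d), (d,a,c)` are corners. -/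
def IsRectangle {p : ℕ} (a b c d : Pt p) : Prop :=
  IsCorner a b d ∧ IsCorner b a c ∧ IsCorner c b d ∧ IsCorner d a c

/-- `□(E)`: the number of non-degenerate rectangles `(a,b,c,d) ∈ E⁴`
(non-degenerate: not all four vertices lie on one line). -/
noncomputable def rectCount (p : ℕ) [Fact p.Prime] (E : Finset (Pt p)) : ℕ :=
  Set.ncard {q : Pt p × Pt p × Pt p × Pt p |
    q.1 ∈ E ∧ q.2.1 ∈ E ∧ q.2.2.1 ∈ E ∧ q.2.2.2 ∈ E ∧
    IsRectangle q.1 q.2.1 q.2.2.1 q.2.2.2 ∧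
    ¬ Collinear (ZMod p) ({q.1, q.2.1, q.2.2.1, q.2.2.2} : Set (Pt p))}

/-- `T(E)`: the number of isosceles triangles, i.e. triples `(a,b,c) ∈ E³`
with `‖a - c‖ = ‖b - c‖ ≠ 0`. -/
def triCount {p : ℕ} (E : Finset (Pt p)) : ℕ :=
  ((E ×ˢ E ×ˢ E).filter fun q =>
    dist2 q.1 q.2.2 = dist2 q.2.1 q.2.2 ∧ dist2 q.1 q.2.2 ≠ 0).card

open Polynomial in
theorem resultant_ne_zero_of_irreducible {A : Type*} [CommRing A] [IsDomain A]
    [UniqueFactorizationMonoid A] {g h : A[X]} (hg : Irreducible g) (hd : g.natDegree ≠ 0)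
    (hgh : ¬ g ∣ h) : resultant g h ≠ 0 := by
  classical
  let _ : NormalizedGCDMonoid A :=
    Classical.choice (inferInstance : Nonempty (NormalizedGCDMonoid A))
  have hprim : g.IsPrimitive := hg.isPrimitive hd
  set F := FractionRing A
  have hinj : Function.Injective (algebraMap A F) := IsFractionRing.injective A F
  have hirr : Irreducible (g.map (algebraMap A F)) :=
    (hprim.irreducible_iff_irreducible_map_fraction_map (K := F)).1 hg
  have hnd : ¬ g.map (algebraMap A F) ∣ h.map (algebraMap A F) := fun hdvd =>
    hgh (hprim.dvd_of_fraction_map_dvd_fraction_map hdvd)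
  have hcop := (hirr.coprime_iff_not_dvd).2 hnd
  intro hres
  have hmap : resultant (g.map (algebraMap A F)) (h.map (algebraMap A F)) = 0 := by
    rw [natDegree_map_eq_of_injective hinj, natDegree_map_eq_of_injective hinj,
      resultant_map_map, hres, map_zero]
  rw [resultant_eq_zero_iff] at hmap
  exact hmap.2 hcop

open Polynomial in
theorem totalDegree_resultant_le {K σ : Type*} [CommRing K] {g h : (MvPolynomial σ K)[X]} {d e : ℕ}
    (hg : ∀ i, (g.coeff i).totalDegree ≤ d) (hh : ∀ i, (h.coeff i).totalDegree ≤ e) (m n : ℕ) :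
    (resultant g h m n).totalDegree ≤ m * e + n * d := by
  classical
  rw [resultant, Matrix.det_apply]
  refine MvPolynomial.totalDegree_finsetSum_le fun s _ => ?_
  have key : ∀ z : ℤˣ, ∀ f : MvPolynomial σ K, (z • f).totalDegree ≤ f.totalDegree := by
    intro z f
    rcases Int.units_eq_one_or z with rfl | rfl
    · simp
    · simp [Units.neg_smul]
  refine (key _ _).trans ((MvPolynomial.totalDegree_finsetProd _ _).trans ?_)
  rw [Fin.sum_univ_add]
  refine add_le_add ?_ ?_
  · refine (Finset.sum_le_card_nsmul _ _ e fun i _ => ?_).trans (by simp)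
    simp only [sylvester, Matrix.of_apply, Fin.addCases_left]
    split_ifs
    · exact hh _
    · simp
  · refine (Finset.sum_le_card_nsmul _ _ d fun i _ => ?_).trans (by simp)
    simp only [sylvester, Matrix.of_apply, Fin.addCases_right]
    split_ifs
    · exact hg _
    · simp

open MvPolynomial in
theorem finSuccEquiv_rename_succ {K : Type*} [CommRing K] {n : ℕ} (u : MvPolynomial (Fin n) K) :
    finSuccEquiv K n (rename Fin.succ u) = Polynomial.C u := by
  induction u using MvPolynomial.induction_on with
  | C a => simp [finSuccEquiv_apply]
  | add p q hp hq => simp [hp, hq]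
  | mul_X p i hp => simp [hp, finSuccEquiv_X_succ]

open MvPolynomial in
theorem exists_elimination {K : Type*} [Field K] {n : ℕ} {g h : MvPolynomial (Fin (n + 1)) K}
    (hg : Irreducible g) (hgh : ¬ g ∣ h) :
    ∃ (u : MvPolynomial (Fin n) K) (q r : MvPolynomial (Fin (n + 1)) K), u ≠ 0 ∧
      u.totalDegree ≤ g.totalDegree * (2 * h.totalDegree + 1) ∧ q * g + r * h = rename Fin.succ u := by
  have hcoef : ∀ (f : MvPolynomial (Fin (n + 1)) K) (i : ℕ),
      ((finSuccEquiv K n f).coeff i).totalDegree ≤ f.totalDegree := by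
    intro f i
    by_cases hi : (finSuccEquiv K n f).coeff i = 0
    · simp [hi]
    · exact (Nat.le_add_right _ _).trans (totalDegree_coeff_finSuccEquiv_add_le f i hi)
  have hdeg : ∀ f : MvPolynomial (Fin (n + 1)) K,
      (finSuccEquiv K n f).natDegree ≤ f.totalDegree := fun f => by
    rw [natDegree_finSuccEquiv]; exact degreeOf_le_totalDegree f 0
  have hgi : Irreducible (finSuccEquiv K n g) := (MulEquiv.irreducible_iff _).2 hg
  by_cases hd : (finSuccEquiv K n g).natDegree = 0
  · rw [Polynomial.natDegree_eq_zero] at hd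
    obtain ⟨u, hu⟩ := hd
    have hug : rename Fin.succ u = g := by
      apply (finSuccEquiv K n).injective
      rw [finSuccEquiv_rename_succ, hu]
    refine ⟨u, 1, 0, ?_, ?_, by simp [hug]⟩
    · rintro rfl
      exact hg.ne_zero (by simpa using hug.symm)
    · have := hcoef g 0
      rw [← hu, Polynomial.coeff_C_zero] at this
      nlinarith
  · set G := finSuccEquiv K n g with hG
    set H := finSuccEquiv K n h with hH
    obtain ⟨q, r, -, -, hqr⟩ := Polynomial.exists_mul_add_mul_eq_C_resultant G H le_rfl le_rfl
      (Or.inl hd)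
    refine ⟨Polynomial.resultant G H, (finSuccEquiv K n).symm q, (finSuccEquiv K n).symm r,
      resultant_ne_zero_of_irreducible hgi hd ?_, ?_, ?_⟩
    · intro hdvd
      exact hgh ((map_dvd_iff (finSuccEquiv K n)).1 hdvd)
    · refine (totalDegree_resultant_le (hcoef g) (hcoef h) _ _).trans ?_
      have h1 := hdeg g
      have h2 := hdeg h
      nlinarith
    · apply (finSuccEquiv K n).injective
      rw [finSuccEquiv_rename_succ, ← hqr]
      simp [hG, hH]
      ring

section Surfaces

open MvPolynomial

theorem pderiv_pderiv_comm {K σ : Type*} [CommRing K] (i j : σ) (f : MvPolynomial σ K) :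
    pderiv i (pderiv j f) = pderiv j (pderiv i f) := by
  classical
  have : ⁅pderiv (R := K) i, pderiv (R := K) j⁆ = 0 := by
    ext k
    rw [Derivation.commutator_apply]
    by_cases h1 : k = i <;> by_cases h2 : k = j <;> simp [pderiv_X, Pi.single_apply, h1, h2] <;>
      split_ifs <;> simp
  have h := congrArg (fun d : Derivation K _ _ => d f) this
  simpa [Derivation.commutator_apply, sub_eq_zero] using h

theorem totalDegree_pderiv_le {K σ : Type*} [CommRing K] (i : σ) (f : MvPolynomial σ K) :
    (pderiv i f).totalDegree ≤ f.totalDegree - 1 := by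
  classical
  conv_lhs => rw [f.as_sum, map_sum]
  refine totalDegree_finsetSum_le fun s hs => ?_
  rw [pderiv_monomial]
  by_cases h : s i = 0
  · simp [h]
  · refine (totalDegree_monomial_le _ _).trans ?_
    have h1 := le_totalDegree hs
    have hle : Finsupp.single i 1 ≤ s := by
      rw [Finsupp.single_le_iff]; omega
    have h2 : (s - Finsupp.single i 1).degree + 1 = s.degree := by
      conv_rhs => rw [← tsub_add_cancel_of_le hle]
      simp
    have h3 : s.degree ≤ f.totalDegree := h1
    change (s - Finsupp.single i 1).degree ≤ _
    omega

theorem degreeOf_eq_zero_of_pderiv_eq_zero {K σ : Type*} [Field K] {p : ℕ} [CharP K p] {i : σ}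
    {f : MvPolynomial σ K} (hf : f.totalDegree < p) (h : pderiv i f = 0) : f.degreeOf i = 0 := by
  classical
  rw [← Nat.le_zero, degreeOf_le_iff]
  intro s hs
  by_contra hne
  have hle : Finsupp.single i 1 ≤ s := by
    rw [Finsupp.single_le_iff]; omega
  have h1 := coeff_pderiv (i := i) f (s - Finsupp.single i 1)
  rw [h, coeff_zero, tsub_add_cancel_of_le hle] at h1
  have h2 : ((s i : ℕ) : K) = 0 := by
    have h3 : ((s - Finsupp.single i 1 : σ →₀ ℕ) i + 1 : ℕ) = s i := by
      simp; omega
    rw [← h3]; push_cast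
    exact (mul_eq_zero.1 h1.symm).resolve_left (mem_support_iff.1 hs)
  rw [CharP.cast_eq_zero_iff K p] at h2
  have h3 := Nat.le_of_dvd (by omega) h2
  have h4 : s i ≤ f.totalDegree := (monomial_le_degreeOf i hs).trans (degreeOf_le_totalDegree f i)
  omega

theorem derivation_aeval {K B σ : Type*} [Fintype σ] [CommRing K] [CommRing B] [Algebra K B]
    (δ : B → B) (hadd : ∀ x y, δ (x + y) = δ x + δ y)
    (hmul : ∀ x y, δ (x * y) = x * δ y + y * δ x) (hδ : ∀ k : K, δ (algebraMap K B k) = 0)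
    (v : σ → B) (f : MvPolynomial σ K) :
    δ (aeval v f) = ∑ i, aeval v (pderiv i f) * δ (v i) := by
  classical
  induction f using MvPolynomial.induction_on with
  | C a => simp [hδ]
  | add p q hp hq => simp [hadd, hp, hq, add_mul, Finset.sum_add_distrib]
  | mul_X p i hp =>
    simp only [map_mul, aeval_X, hmul, Derivation.leibniz, hp, smul_eq_mul, pderiv_X, map_add,
      add_mul, Finset.sum_add_distrib, Finset.mul_sum]
    congr 1
    · rw [Finset.sum_eq_single i]
      · simp
      · intro j _ hj; simp [hj.symm]
      · simp
    · exact Finset.sum_congr rfl fun j _ => by ring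

/-- Restriction of a trivariate polynomial to the line `(a X + b, X, α)`. -/
noncomputable def redHom {K : Type*} [CommRing K] (a b α : K) :
    MvPolynomial (Fin 3) K →ₐ[K] Polynomial K :=
  aeval ![Polynomial.C a * Polynomial.X + Polynomial.C b, Polynomial.X, Polynomial.C α]

/-- Restriction of a trivariate polynomial to the line `(c X + e, β, X)`. -/
noncomputable def blueHom {K : Type*} [CommRing K] (c e β : K) :
    MvPolynomial (Fin 3) K →ₐ[K] Polynomial K :=
  aeval ![Polynomial.C c * Polynomial.X + Polynomial.C e, Polynomial.C β, Polynomial.X]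

theorem natDegree_blueHom_le {K : Type*} [CommRing K] (c e β : K) (f : MvPolynomial (Fin 3) K) :
    (blueHom c e β f).natDegree ≤ f.totalDegree := by
  refine (aeval_natDegree_le (n := 1) f le_rfl _ fun i => ?_).trans (by simp)
  fin_cases i
  · exact Polynomial.natDegree_linear_le
  · simp
  · exact Polynomial.natDegree_X_le

theorem eval_redHom {K : Type*} [CommRing K] (a b α y : K) (f : MvPolynomial (Fin 3) K) :
    (redHom a b α f).eval y = aeval ![a * y + b, y, α] f := by
  have : (Polynomial.aeval y).comp (redHom a b α) = aeval ![a * y + b, y, α] := by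
    ext i; fin_cases i <;> simp [redHom]
  rw [← this]; simp

theorem eval_blueHom {K : Type*} [CommRing K] (c e β x : K) (f : MvPolynomial (Fin 3) K) :
    (blueHom c e β f).eval x = aeval ![c * x + e, β, x] f := by
  have : (Polynomial.aeval x).comp (blueHom c e β) = aeval ![c * x + e, β, x] := by
    ext i; fin_cases i <;> simp [blueHom]
  rw [← this]; simp

theorem blueHom_eq_zero {K : Type*} [Field K] {a b : K → K} {c e β : K}
    {f : MvPolynomial (Fin 3) K} (T : Finset K)
    (hT : ∀ α ∈ T, a α * β + b α = c * α + e ∧ redHom (a α) (b α) α f = 0)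
    (hc : f.totalDegree < T.card) : blueHom c e β f = 0 := by
  refine Polynomial.eq_zero_of_natDegree_lt_card_of_eval_eq_zero' _ T (fun α hα => ?_)
    ((natDegree_blueHom_le _ _ _ _).trans_lt hc)
  rw [eval_blueHom, ← (hT α hα).1, ← eval_redHom, (hT α hα).2, Polynomial.eval_zero]

theorem blueHom_rename {K : Type*} [CommRing K] (c e β : K) (u : MvPolynomial (Fin 2) K) :
    blueHom c e β (rename Fin.succ u) = aeval ![Polynomial.C β, Polynomial.X] u := by
  rw [blueHom, aeval_rename]; rfl

theorem exists_bivariate {K : Type*} [Field K] {u : MvPolynomial (Fin 2) K} (hu : u ≠ 0) :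
    ∃ P : Polynomial (Polynomial K), P ≠ 0 ∧ P.natDegree ≤ u.totalDegree ∧
      (∀ z : Polynomial K, P.eval z = aeval ![z, Polynomial.X] u) ∧
      ∀ z : Polynomial (Polynomial K), P.comp z = aeval ![z, Polynomial.C Polynomial.X] u := by
  set φ : MvPolynomial (Fin 1) K →ₐ[K] Polynomial K := aeval fun _ => Polynomial.X with hφ
  have hinj : Function.Injective φ := by
    have : (Polynomial.aeval (X 0 : MvPolynomial (Fin 1) K)).comp φ = AlgHom.id K _ := by
      ext i; fin_cases i; simp [hφ]
    exact Function.LeftInverse.injective (g := Polynomial.aeval (X 0 : MvPolynomial (Fin 1) K))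
      fun x => by simpa using congrArg (fun t : _ →ₐ[K] _ => t x) this
  refine ⟨(finSuccEquiv K 1 u).map φ.toRingHom, ?_, ?_, fun z => ?_, fun z => ?_⟩
  · rwa [Ne, Polynomial.map_eq_zero_iff hinj, map_eq_zero_iff _ (finSuccEquiv K 1).injective]
  · refine (Polynomial.natDegree_map_le).trans ?_
    rw [natDegree_finSuccEquiv]; exact degreeOf_le_totalDegree u 0
  · have : ((Polynomial.evalRingHom z).comp (Polynomial.mapRingHom φ.toRingHom)).comp
        (finSuccEquiv K 1 : _ →+* _) = (aeval ![z, Polynomial.X] :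
        MvPolynomial (Fin 2) K →ₐ[K] Polynomial K).toRingHom := by
      refine MvPolynomial.ringHom_ext (fun k => ?_) fun i => ?_
      · simp [finSuccEquiv_apply, hφ]
      · refine Fin.cases ?_ (fun j => ?_) i
        · simp [finSuccEquiv_X_zero]
        · simp [finSuccEquiv_X_succ, hφ]
    exact congrArg (fun t : _ →+* _ => t u) this
  · have : ((Polynomial.compRingHom z).comp (Polynomial.mapRingHom φ.toRingHom)).comp
        (finSuccEquiv K 1 : _ →+* _) =
          (aeval ![z, Polynomial.C Polynomial.X] :
            MvPolynomial (Fin 2) K →ₐ[K] Polynomial (Polynomial K)).toRingHom := by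
      refine MvPolynomial.ringHom_ext (fun k => ?_) fun i => ?_
      · simp [finSuccEquiv_apply, hφ]
      · refine Fin.cases ?_ (fun j => ?_) i
        · simp [finSuccEquiv_X_zero]
        · simp [finSuccEquiv_X_succ, hφ]
    exact congrArg (fun t : _ →+* _ => t u) this

theorem card_le_totalDegree {K : Type*} [Field K] {u : MvPolynomial (Fin 2) K} (hu : u ≠ 0)
    (S : Finset K) (hS : ∀ β ∈ S, aeval ![Polynomial.C β, Polynomial.X] u = 0) :
    S.card ≤ u.totalDegree := by
  classical
  obtain ⟨P, hP, hd, he, -⟩ := exists_bivariate hu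
  by_contra! hlt
  refine hP (Polynomial.eq_zero_of_natDegree_lt_card_of_eval_eq_zero P (f := fun β : S =>
    Polynomial.C (β : K)) ?_ (fun β => ?_) ?_)
  · exact (Polynomial.C_injective).comp Subtype.val_injective
  · rw [he, hS _ β.2]
  · simpa using hd.trans_lt hlt

theorem aeval_linear_ne_zero {K : Type*} [Field K] {u : MvPolynomial (Fin 2) K} (hu : u ≠ 0)
    (r s : Polynomial K) (hs : s ≠ 0) :
    (aeval ![Polynomial.C r + Polynomial.X * Polynomial.C s, Polynomial.C Polynomial.X] u :
      Polynomial (Polynomial K)) ≠ 0 := by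
  obtain ⟨P, hP, -, -, he⟩ := exists_bivariate hu
  rw [← he, Ne, Polynomial.comp_eq_zero_iff]
  rintro (h | ⟨-, h⟩)
  · exact hP h
  · have := congrArg (fun t => Polynomial.coeff (R := Polynomial K) t 1) h
    simp [Polynomial.coeff_C] at this
    exact hs this

theorem card_common_blue_le {K : Type*} [Field K] {g h : MvPolynomial (Fin 3) K}
    (hg : Irreducible g) (hgh : ¬ g ∣ h) (c e : K → K) (S : Finset K)
    (hS : ∀ β ∈ S, blueHom (c β) (e β) β g = 0 ∧ blueHom (c β) (e β) β h = 0) :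
    S.card ≤ g.totalDegree * (2 * h.totalDegree + 1) := by
  obtain ⟨u, q, r, hu, hd, he⟩ := exists_elimination hg hgh
  refine (card_le_totalDegree hu S fun β hβ => ?_).trans hd
  rw [← blueHom_rename (c β) (e β), ← he, map_add, map_mul, map_mul, (hS β hβ).1, (hS β hβ).2]
  simp

/-- The numerator of the second derivative of the plane curve `g(w, y) = 0`. -/
noncomputable def flexPoly {K : Type*} [CommRing K] (g : MvPolynomial (Fin 3) K) :
    MvPolynomial (Fin 3) K :=
  pderiv 1 (pderiv 1 g) * pderiv 0 g ^ 2 - 2 * pderiv 0 (pderiv 1 g) * pderiv 0 g * pderiv 1 g +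
    pderiv 0 (pderiv 0 g) * pderiv 1 g ^ 2

theorem totalDegree_flexPoly_le {K : Type*} [Field K] (g : MvPolynomial (Fin 3) K) :
    (flexPoly g).totalDegree ≤ 3 * g.totalDegree := by
  have h1 : ∀ (i : Fin 3) (f : MvPolynomial (Fin 3) K), f.totalDegree ≤ g.totalDegree →
      (pderiv i f).totalDegree ≤ g.totalDegree := fun i f hf =>
    ((totalDegree_pderiv_le i f).trans (Nat.sub_le _ _)).trans hf
  have hm : ∀ {m n : ℕ} (f h : MvPolynomial (Fin 3) K), f.totalDegree ≤ m → h.totalDegree ≤ n →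
      (f * h).totalDegree ≤ m + n := fun f h hf hh =>
    (totalDegree_mul f h).trans (add_le_add hf hh)
  have h2 : (2 : MvPolynomial (Fin 3) K).totalDegree ≤ 0 := by
    rw [← map_ofNat (C (R := K)) 2, totalDegree_C]
  have g0 := h1 0 g le_rfl
  have g1 := h1 1 g le_rfl
  rw [flexPoly, pow_two, pow_two]
  refine (totalDegree_add _ _).trans (max_le ((totalDegree_sub _ _).trans (max_le ?_ ?_)) ?_)
  · exact (hm _ _ (h1 1 _ g1) (hm _ _ g0 g0)).trans (by omega)
  · exact (hm _ _ (hm _ _ (hm _ _ h2 (h1 0 _ g1)) g0) g1).trans (by omega)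
  · exact (hm _ _ (h1 0 _ g0) (hm _ _ g1 g1)).trans (by omega)

theorem derivative_redHom {K : Type*} [CommRing K] (a b α : K) (f : MvPolynomial (Fin 3) K) :
    Polynomial.derivative (redHom a b α f) =
      Polynomial.C a * redHom a b α (pderiv 0 f) + redHom a b α (pderiv 1 f) := by
  have h := derivation_aeval (K := K) (fun x : Polynomial K => Polynomial.derivative x)
    (by simp) (by intro x y; simp; ring) (by simp)
    ![Polynomial.C a * Polynomial.X + Polynomial.C b, Polynomial.X, Polynomial.C α] f
  simp [Fin.sum_univ_three] at h
  rw [redHom, h]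
  ring

theorem redHom_flexPoly {K : Type*} [CommRing K] {a b α : K} {g : MvPolynomial (Fin 3) K}
    (hg : redHom a b α g = 0) : redHom a b α (flexPoly g) = 0 := by
  have h1 := derivative_redHom a b α g
  rw [hg, Polynomial.derivative_zero] at h1
  have h2 := congrArg Polynomial.derivative h1
  simp only [Polynomial.derivative_zero, Polynomial.derivative_add, Polynomial.derivative_C_mul,
    derivative_redHom] at h2
  rw [pderiv_pderiv_comm 1 0] at h2
  simp only [flexPoly, map_add, map_sub, map_mul, map_pow, map_ofNat]
  set g0 := redHom a b α (pderiv 0 g)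
  set g1 := redHom a b α (pderiv 1 g)
  have h3 : g1 = - (Polynomial.C a * g0) := by linear_combination -h1
  rw [h3]
  linear_combination - g0 ^ 2 * h2

theorem dvd_coeff_flow {K : Type*} [Field K] {p : ℕ} [CharP K p] {g : MvPolynomial (Fin 3) K}
    (hg : Irreducible g) (hp : g.totalDegree < p) (hgw : ¬ g ∣ pderiv 0 g) (hG : g ∣ flexPoly g)
    (n : ℕ) :
    g ∣ (aeval ![Polynomial.C (X 0) - Polynomial.X * Polynomial.C (pderiv 1 g),
      Polynomial.C (X 1) + Polynomial.X * Polynomial.C (pderiv 0 g), Polynomial.C (X 2)] g :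
        Polynomial (MvPolynomial (Fin 3) K)).coeff n := by
  set v : Fin 3 → Polynomial (MvPolynomial (Fin 3) K) :=
    ![Polynomial.C (X 0) - Polynomial.X * Polynomial.C (pderiv 1 g),
      Polynomial.C (X 1) + Polynomial.X * Polynomial.C (pderiv 0 g), Polynomial.C (X 2)] with hv
  have hprime : Prime g := hg.prime
  set D : Derivation K (MvPolynomial (Fin 3) K) (MvPolynomial (Fin 3) K) :=
    pderiv 0 g • pderiv 1 - pderiv 1 g • pderiv 0 with hD
  have hDf : ∀ f, D f = pderiv 0 g * pderiv 1 f - pderiv 1 g * pderiv 0 f := fun f => by simp [hD]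
  let _ : Differential (MvPolynomial (Fin 3) K) := ⟨D.restrictScalars ℤ⟩
  obtain ⟨δ, hadd, hmul, hcoef⟩ : ∃ δ : Polynomial (MvPolynomial (Fin 3) K) →
      Polynomial (MvPolynomial (Fin 3) K), (∀ x y, δ (x + y) = δ x + δ y) ∧
      (∀ x y, δ (x * y) = x * δ y + y * δ x) ∧ ∀ x i, (δ x).coeff i = D (x.coeff i) :=
    ⟨fun x => Differential.mapCoeffs x, fun x y => map_add _ x y,
      fun x y => Derivation.leibniz _ x y, fun x i => rfl⟩
  have hδC : ∀ x, δ (Polynomial.C x) = Polynomial.C (D x) := fun x => by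
    ext1 i; rw [hcoef, Polynomial.coeff_C, Polynomial.coeff_C]; split_ifs <;> simp
  have hδX : δ Polynomial.X = 0 := by
    ext1 i; rw [hcoef, Polynomial.coeff_X]; split_ifs <;> simp
  have hT := derivation_aeval (K := K)
    (fun x : Polynomial (MvPolynomial (Fin 3) K) => Polynomial.derivative x)
    (by simp) (by intro x y; simp; ring)
    (fun k => by simp [IsScalarTower.algebraMap_apply K (MvPolynomial (Fin 3) K)]) v g
  have hC := derivation_aeval (K := K) δ hadd hmul (fun k => by
    rw [IsScalarTower.algebraMap_apply K (MvPolynomial (Fin 3) K), Polynomial.algebraMap_apply,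
      Algebra.algebraMap_self, RingHom.id_apply, hδC, Derivation.map_algebraMap, map_zero]) v g
  simp only [Fin.sum_univ_three] at hT hC
  set P := aeval v g with hP
  have v0 : v 0 = Polynomial.C (X 0) + Polynomial.X * Polynomial.C (- pderiv 1 g) := by
    simp [hv, sub_eq_add_neg]; ring
  have v1 : v 1 = Polynomial.C (X 1) + Polynomial.X * Polynomial.C (pderiv 0 g) := rfl
  have v2 : v 2 = Polynomial.C (X 2) := rfl
  rw [v0, v1, v2] at hT hC
  simp only [hadd, hmul, hδC, hδX, hDf, pderiv_X] at hC
  simp at hT hC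
  have key : Polynomial.C (pderiv 0 g) * δ P =
      Polynomial.C (pderiv 0 g) * Polynomial.derivative P +
        Polynomial.C (D (pderiv 0 g)) * (Polynomial.X * Polynomial.derivative P) -
        Polynomial.C (flexPoly g) * (Polynomial.X * aeval v (pderiv 0 g)) := by
    rw [hC, hT, flexPoly, hDf, pderiv_pderiv_comm 1 0]
    simp only [map_add, map_sub, map_mul, map_pow, map_ofNat]
    ring
  have hDg : ∀ f, g ∣ f → g ∣ D f := by
    rintro _ ⟨f, rfl⟩
    rw [hDf, pderiv_mul, pderiv_mul]
    exact ⟨pderiv 0 g * pderiv 1 f - pderiv 1 g * pderiv 0 f, by ring⟩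
  have hlow : ∀ n < p, g ∣ P.coeff n := by
    intro n
    induction n with
    | zero =>
      intro _
      have : ((Polynomial.aeval (0 : MvPolynomial (Fin 3) K)).restrictScalars K).comp (aeval v) =
          AlgHom.id K _ := by
        ext i; fin_cases i <;> simp [hv]
      have h := congrArg (fun t : _ →ₐ[K] _ => t g) this
      simp at h
      rw [Polynomial.coeff_zero_eq_eval_zero]
      exact (dvd_of_eq h.symm)
    | succ n ih =>
      intro hn
      have hd := ih (by omega)
      have hk := congrArg (fun t => Polynomial.coeff t n) key
      simp only [Polynomial.coeff_add, Polynomial.coeff_sub, Polynomial.coeff_C_mul, hcoef,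
        Polynomial.coeff_derivative] at hk
      have hX : g ∣ (Polynomial.X * Polynomial.derivative P).coeff n := by
        cases n with
        | zero => simp
        | succ m =>
          rw [Polynomial.coeff_X_mul, Polynomial.coeff_derivative]
          exact hd.mul_right _
      have h1 : g ∣ pderiv 0 g * (P.coeff (n + 1) * ((n : MvPolynomial (Fin 3) K) + 1)) := by
        rw [show pderiv 0 g * (P.coeff (n + 1) * ((n : MvPolynomial (Fin 3) K) + 1)) =
          pderiv 0 g * D (P.coeff n) - D (pderiv 0 g) * (Polynomial.X * Polynomial.derivative P).coeff n +
            flexPoly g * (Polynomial.X * aeval v (pderiv 0 g)).coeff n by linear_combination -hk]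
        exact dvd_add (dvd_sub ((hDg _ hd).mul_left _) (hX.mul_left _)) (hG.mul_right _)
      have h2 := (hprime.dvd_or_dvd h1).resolve_left hgw
      refine (hprime.dvd_or_dvd h2).resolve_right fun h3 => ?_
      have h4 : ((n + 1 : ℕ) : K) ≠ 0 := by
        rw [Ne, CharP.cast_eq_zero_iff K p]
        exact fun h => absurd (Nat.le_of_dvd (by omega) h) (by omega)
      refine hprime.not_isUnit (isUnit_of_dvd_unit h3 ?_)
      have h5 : (n : MvPolynomial (Fin 3) K) + 1 = C ((n + 1 : ℕ) : K) := by simp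
      rw [h5]
      exact (isUnit_iff_ne_zero.2 h4).map C
  by_cases hn : n < p
  · exact hlow n hn
  · rw [Polynomial.coeff_eq_zero_of_natDegree_lt]
    · exact dvd_zero _
    · rw [hP, ← aeval_map_algebraMap (MvPolynomial (Fin 3) K)]
      refine lt_of_le_of_lt (aeval_natDegree_le (m := g.totalDegree) (n := 1) _
        (Finset.sup_mono (support_map_subset _ _)) v ?_) (by omega)
      intro i
      fin_cases i
      · rw [hv]; simp; compute_degree
      · rw [hv]; simp; compute_degree
      · rw [hv]; simp

theorem dvd_quadric {K : Type*} [Field K] {p : ℕ} [CharP K p] {g : MvPolynomial (Fin 3) K}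
    (hg : Irreducible g) (hp : g.totalDegree < p) (hgw : ¬ g ∣ pderiv 0 g) (hG : g ∣ flexPoly g)
    {c₀ e₀ β₀ c₁ e₁ β₁ : K} (h₀ : blueHom c₀ e₀ β₀ g = 0)
    (h₁ : blueHom c₁ e₁ β₁ g = 0) (hw : blueHom c₀ e₀ β₀ (pderiv 0 g) ≠ 0) :
    g ∣ C (β₁ - β₀) * (X 0 - (C c₀ * X 2 + C e₀)) -
      (X 1 - C β₀) * (C (c₁ - c₀) * X 2 + C (e₁ - e₀)) := by
  have hprime : Prime g := hg.prime
  set gw := blueHom c₀ e₀ β₀ (pderiv 0 g) with hgw'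
  set gy := blueHom c₀ e₀ β₀ (pderiv 1 g) with hgy'
  set ι : Polynomial K →ₐ[K] MvPolynomial (Fin 3) K := Polynomial.aeval (X 2) with hι
  have hbι : ∀ (c e β : K) (f : Polynomial K), blueHom c e β (ι f) = f := fun c e β f => by
    have : (blueHom c e β).comp ι = AlgHom.id K _ := by
      ext; simp [blueHom, hι]
    exact congrArg (fun t : _ →ₐ[K] _ => t f) this
  set v : Fin 3 → Polynomial (MvPolynomial (Fin 3) K) :=
    ![Polynomial.C (X 0) - Polynomial.X * Polynomial.C (pderiv 1 g),
      Polynomial.C (X 1) + Polynomial.X * Polynomial.C (pderiv 0 g), Polynomial.C (X 2)] with hv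
  set Ψ : MvPolynomial (Fin 3) K →ₐ[K] Polynomial (Polynomial K) :=
    aeval ![Polynomial.C (Polynomial.C c₀ * Polynomial.X + Polynomial.C e₀) -
        Polynomial.X * Polynomial.C gy,
      Polynomial.C (Polynomial.C β₀) + Polynomial.X * Polynomial.C gw,
      Polynomial.C Polynomial.X] with hΨ
  have hΨg : Ψ g = 0 := by
    have h1 : (Polynomial.mapAlgHom (blueHom c₀ e₀ β₀)).comp (aeval v) = Ψ := by
      have hb : ∀ i, blueHom c₀ e₀ β₀ (X i) =
          ![Polynomial.C c₀ * Polynomial.X + Polynomial.C e₀, Polynomial.C β₀, Polynomial.X] i :=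
        fun i => by simp [blueHom]
      ext i : 1
      fin_cases i
      · simp [hv, hΨ, hb, hgy', Polynomial.X_mul_C]
      · simp [hv, hΨ, hb, hgw']
      · simp [hv, hΨ, hb]
    rw [← h1, AlgHom.comp_apply]
    ext1 n
    obtain ⟨q, hq⟩ := dvd_coeff_flow hg hp hgw hG n
    rw [Polynomial.coe_mapAlgHom, Polynomial.coeff_map, hv, hq]
    simp [h₀]
  set Λ : MvPolynomial (Fin 3) K := ι gw * (X 0 - (C c₀ * X 2 + C e₀)) + ι gy * (X 1 - C β₀) with hΛ
  have hΨι : ∀ f, Ψ (ι f) = Polynomial.C f := fun f => by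
    have : Ψ.comp ι = Polynomial.CAlgHom := by
      refine Polynomial.algHom_ext ?_
      simp [hΨ, hι]
    exact congrArg (fun t : _ →ₐ[K] _ => t f) this
  have hgΛ : g ∣ Λ := by
    by_contra hnd
    obtain ⟨u, q, r, hu, -, he⟩ := exists_elimination hg hnd
    have hΨΛ : Ψ Λ = 0 := by
      have h0 : Ψ (X 0) = Polynomial.C (Polynomial.C c₀ * Polynomial.X + Polynomial.C e₀) -
        Polynomial.X * Polynomial.C gy := by simp [hΨ]
      have h1 : Ψ (X 1) = Polynomial.C (Polynomial.C β₀) + Polynomial.X * Polynomial.C gw := by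
        simp [hΨ]
      have h2 : Ψ (X 2) = Polynomial.C Polynomial.X := by simp [hΨ]
      have h3 : ∀ z, Ψ (C z) = Polynomial.C (Polynomial.C z) := fun z => by
        rw [hΨ, aeval_C]; rfl
      simp only [hΛ, map_add, map_mul, map_sub, hΨι, h0, h1, h2, h3]
      ring
    have h2 := congrArg Ψ he
    rw [map_add, map_mul, map_mul, hΨg, hΨΛ, mul_zero, mul_zero, add_zero, hΨ, aeval_rename] at h2
    exact aeval_linear_ne_zero hu (Polynomial.C β₀) gw hw h2.symm
  have hrel : gw * (Polynomial.C (c₁ - c₀) * Polynomial.X + Polynomial.C (e₁ - e₀)) +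
      gy * Polynomial.C (β₁ - β₀) = 0 := by
    obtain ⟨q, hq⟩ := hgΛ
    have h2 := congrArg (blueHom c₁ e₁ β₁) hq
    rw [map_mul, h₁, zero_mul, hΛ, map_add, map_mul, map_mul, hbι, hbι] at h2
    have h3 : blueHom c₁ e₁ β₁ (X 0 - (C c₀ * X 2 + C e₀)) =
        Polynomial.C (c₁ - c₀) * Polynomial.X + Polynomial.C (e₁ - e₀) := by
      simp [blueHom]; ring
    have h4 : blueHom c₁ e₁ β₁ (X 1 - C β₀) = Polynomial.C (β₁ - β₀) := by simp [blueHom]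
    rw [← h2, h3, h4]
  have hrel' := congrArg ι hrel
  have hkey : C (β₁ - β₀) * Λ = ι gw * (C (β₁ - β₀) * (X 0 - (C c₀ * X 2 + C e₀)) -
      (X 1 - C β₀) * (C (c₁ - c₀) * X 2 + C (e₁ - e₀))) := by
    simp only [map_add, map_mul, map_zero] at hrel'
    have hιC : ∀ z, ι (Polynomial.C z) = C z := fun z => by simp [hι, algebraMap_eq]
    have hιX : ι Polynomial.X = X 2 := by simp [hι]
    rw [hιC, hιC, hιC, hιX] at hrel'
    rw [hΛ]
    linear_combination (X 1 - C β₀) * hrel'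
  refine (hprime.dvd_or_dvd (hkey ▸ hgΛ.mul_left _)).resolve_left ?_
  rintro ⟨q, hq⟩
  have h2 := congrArg (blueHom c₀ e₀ β₀) hq
  rw [hbι, map_mul, h₀, zero_mul] at h2
  exact hw h2

theorem card_rich_irreducible {K : Type*} [Field K] [DecidableEq K] {p : ℕ} [CharP K p]
    {R S : Finset K} {a b c e : K → K} {k : ℕ}
    (hk : ∀ s t u v : K, (R.filter fun α => a α = s * α + t ∧ b α = u * α + v).card ≤ k)
    {g : MvPolynomial (Fin 3) K} (hg : Irreducible g) (hp : g.totalDegree < p) (hd : 1 ≤ g.totalDegree) :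
    (S.filter fun β => 4 * g.totalDegree + k < (R.filter fun α => a α * β + b α = c β * α + e β ∧
      redHom (a α) (b α) α g = 0).card).card ≤ 7 * g.totalDegree ^ 2 := by
  set d := g.totalDegree with hdd
  set S' := S.filter fun β => 4 * d + k < (R.filter fun α => a α * β + b α = c β * α + e β ∧
      redHom (a α) (b α) α g = 0).card with hS'
  have hblue : ∀ f : MvPolynomial (Fin 3) K, f.totalDegree ≤ 4 * d →
      (∀ α ∈ R, redHom (a α) (b α) α g = 0 → redHom (a α) (b α) α f = 0) →
      ∀ β ∈ S', blueHom (c β) (e β) β f = 0 := by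
    intro f hf hr β hβ
    refine blueHom_eq_zero (a := a) (b := b) (R.filter fun α => a α * β + b α = c β * α + e β ∧
      redHom (a α) (b α) α g = 0) ?_ ?_
    · intro α hα
      rw [Finset.mem_filter] at hα
      exact ⟨hα.2.1, hr α hα.1 hα.2.2⟩
    · have := (Finset.mem_filter.1 hβ).2
      omega
  have hg0 := hblue g (by omega) fun _ _ h => h
  by_cases hG : g ∣ flexPoly g
  swap
  · have := card_common_blue_le hg hG c e S' fun β hβ => ⟨hg0 β hβ, hblue _
      ((totalDegree_flexPoly_le g).trans (by omega)) (fun α _ h => redHom_flexPoly h) β hβ⟩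
    have h2 := totalDegree_flexPoly_le g
    nlinarith
  by_cases hw : pderiv 0 g = 0
  · have h1 := degreeOf_eq_zero_of_pderiv_eq_zero hp hw
    rw [← natDegree_finSuccEquiv, Polynomial.natDegree_eq_zero] at h1
    obtain ⟨u, hu⟩ := h1
    have hug : rename Fin.succ u = g := by
      apply (finSuccEquiv K 2).injective
      rw [finSuccEquiv_rename_succ, hu]
    have hu0 : u ≠ 0 := by
      rintro rfl
      exact hg.ne_zero (by simpa using hug.symm)
    have hud : u.totalDegree ≤ d := by
      have hc : (finSuccEquiv K 2 g).coeff 0 = u := by rw [← hu, Polynomial.coeff_C_zero]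
      rw [← hc]
      exact (Nat.le_add_right _ _).trans
        (totalDegree_coeff_finSuccEquiv_add_le g 0 (by rwa [hc]))
    have := card_le_totalDegree hu0 S' fun β hβ => by
      rw [← blueHom_rename (c β) (e β), hug]; exact hg0 β hβ
    nlinarith
  have hgw : ¬ g ∣ pderiv 0 g := fun h => by
    have h1 := totalDegree_le_of_dvd_of_isDomain h hw
    have h2 := totalDegree_pderiv_le 0 g
    omega
  by_cases hall : ∀ β ∈ S', blueHom (c β) (e β) β (pderiv 0 g) = 0
  · have := card_common_blue_le hg hgw c e S' fun β hβ => ⟨hg0 β hβ, hall β hβ⟩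
    have h2 := totalDegree_pderiv_le 0 g
    have h3 : (pderiv 0 g).totalDegree ≤ d := by omega
    nlinarith
  push Not at hall
  obtain ⟨β₀, hβ₀, hne⟩ := hall
  have hsub : S' ⊆ {β₀} := by
    intro β₁ hβ₁
    rw [Finset.mem_singleton]
    by_contra hβ
    have hdvd := dvd_quadric hg hp hgw hG (hg0 β₀ hβ₀) (hg0 β₁ hβ₁) hne
    have hr := (Finset.mem_filter.1 hβ₁).2
    have hδ : β₁ - β₀ ≠ 0 := sub_ne_zero.2 hβ
    set s := (c β₁ - c β₀) / (β₁ - β₀)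
    set t := (e β₁ - e β₀) / (β₁ - β₀)
    have hs : s * (β₁ - β₀) = c β₁ - c β₀ := div_mul_cancel₀ _ hδ
    have ht : t * (β₁ - β₀) = e β₁ - e β₀ := div_mul_cancel₀ _ hδ
    have hle := hk s t (c β₀ - β₀ * s) (e β₀ - β₀ * t)
    have : (R.filter fun α => a α * β₁ + b α = c β₁ * α + e β₁ ∧
        redHom (a α) (b α) α g = 0) ⊆ (R.filter fun α => a α = s * α + t ∧
          b α = (c β₀ - β₀ * s) * α + (e β₀ - β₀ * t)) := by
      intro α hα
      rw [Finset.mem_filter] at hα ⊢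
      obtain ⟨q, hq⟩ := hdvd
      have h2 := congrArg (redHom (a α) (b α) α) hq
      rw [map_mul, hα.2.2, zero_mul] at h2
      have e0 := congrArg (Polynomial.eval 0) h2
      have e1 := congrArg (Polynomial.eval 1) h2
      simp [redHom] at e0 e1
      rw [← hs, ← ht] at e0 e1
      have ha : a α = s * α + t := by
        apply mul_left_cancel₀ hδ
        linear_combination e1 - e0
      refine ⟨hα.1, ha, ?_⟩
      apply mul_left_cancel₀ hδ
      rw [ha] at *
      linear_combination e0
    have := Finset.card_le_card this
    omega
  have := Finset.card_le_card hsub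
  rw [Finset.card_singleton] at this
  nlinarith

theorem redHom_C_ne_zero {K : Type*} [Field K] {f : MvPolynomial (Fin 3) K} (hf : f ≠ 0)
    (hd : f.totalDegree = 0) (a b α : K) : redHom a b α f ≠ 0 := by
  rw [totalDegree_eq_zero_iff_eq_C] at hd
  rw [hd] at hf ⊢
  intro h
  apply hf
  have : (Polynomial.C (coeff 0 f) : Polynomial K) = 0 := by
    simpa [redHom, aeval_C] using h
  rw [Polynomial.C_eq_zero.1 this, C_0]

theorem card_rich_le {K : Type*} [Field K] [DecidableEq K] {p : ℕ} [CharP K p]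
    {R S : Finset K} {a b c e : K → K} {k : ℕ}
    (hk : ∀ s t u v : K, (R.filter fun α => a α = s * α + t ∧ b α = u * α + v).card ≤ k)
    (f : MvPolynomial (Fin 3) K) (hf : f ≠ 0) (hp : f.totalDegree < p) :
    (S.filter fun β => 4 * f.totalDegree + k < (R.filter fun α => a α * β + b α = c β * α + e β ∧
      redHom (a α) (b α) α f = 0).card).card ≤ 10 * f.totalDegree ^ 2 := by
  induction hn : f.totalDegree using Nat.strong_induction_on generalizing f with
  | _ n ih =>
  subst hn
  by_cases h0 : f.totalDegree = 0
  · have : (S.filter fun β => 4 * f.totalDegree + k < (R.filter fun α =>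
        a α * β + b α = c β * α + e β ∧ redHom (a α) (b α) α f = 0).card) = ∅ := by
      refine Finset.filter_eq_empty_iff.2 fun β _ => ?_
      simp [redHom_C_ne_zero hf h0]
    rw [this]; simp
  have hunit : ¬ IsUnit f := fun h => by
    obtain ⟨q, hq⟩ := h.exists_right_inv
    have hq0 : q ≠ 0 := by rintro rfl; simp at hq
    have := totalDegree_mul_of_isDomain hf hq0
    rw [hq, totalDegree_one] at this
    omega
  obtain ⟨g, hg, h, rfl⟩ := WfDvdMonoid.exists_irreducible_factor hunit hf
  have hh0 : h ≠ 0 := right_ne_zero_of_mul hf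
  have hdeg := totalDegree_mul_of_isDomain hg.ne_zero hh0
  have hg1 : 1 ≤ g.totalDegree := by
    by_contra hlt
    have h1 : g.totalDegree = 0 := by omega
    rw [totalDegree_eq_zero_iff_eq_C] at h1
    apply hg.not_isUnit
    rw [h1]
    refine IsUnit.map C (isUnit_iff_ne_zero.2 fun h2 => hg.ne_zero ?_)
    rw [h1, h2, C_0]
  have ihh := ih h.totalDegree (by omega) h hh0 (by omega) rfl
  by_cases hgh : g ∣ h
  · refine (Finset.card_le_card ?_).trans (ihh.trans (Nat.mul_le_mul_left _
      (Nat.pow_le_pow_left (by omega) 2)))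
    refine Finset.monotone_filter_right _ fun β _ hβ => ?_
    refine lt_of_le_of_lt (by omega) (hβ.trans_le (Finset.card_le_card ?_))
    refine Finset.monotone_filter_right _ fun α _ hα => ⟨hα.1, ?_⟩
    have h2 := hα.2
    rw [map_mul, mul_eq_zero] at h2
    rcases h2 with h2 | h2
    · obtain ⟨q, rfl⟩ := hgh
      rw [map_mul, h2, zero_mul]
    · exact h2
  have hirr := card_rich_irreducible (S := S) (c := c) (e := e) hk hg (by omega) hg1
  have hbez := card_common_blue_le hg hgh c e (S.filter fun β =>
    blueHom (c β) (e β) β g = 0 ∧ blueHom (c β) (e β) β h = 0)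
    fun β hβ => (Finset.mem_filter.1 hβ).2
  have hsub : (S.filter fun β => 4 * (g * h).totalDegree + k < (R.filter fun α =>
        a α * β + b α = c β * α + e β ∧ redHom (a α) (b α) α (g * h) = 0).card) ⊆
      (S.filter fun β => blueHom (c β) (e β) β g = 0 ∧ blueHom (c β) (e β) β h = 0) ∪
      ((S.filter fun β => 4 * g.totalDegree + k < (R.filter fun α =>
        a α * β + b α = c β * α + e β ∧ redHom (a α) (b α) α g = 0).card) ∪
      (S.filter fun β => 4 * h.totalDegree + k < (R.filter fun α =>
        a α * β + b α = c β * α + e β ∧ redHom (a α) (b α) α h = 0).card)) := by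
    intro β hβ
    rw [Finset.mem_filter] at hβ
    simp only [Finset.mem_union, Finset.mem_filter, hβ.1, true_and]
    by_contra! hcon
    obtain ⟨hc1, hc2, hc3⟩ := hcon
    have hle : (R.filter fun α => a α * β + b α = c β * α + e β ∧
          redHom (a α) (b α) α (g * h) = 0).card ≤
        (R.filter fun α => a α * β + b α = c β * α + e β ∧ redHom (a α) (b α) α g = 0).card +
        (R.filter fun α => a α * β + b α = c β * α + e β ∧ redHom (a α) (b α) α h = 0).card := by
      refine (Finset.card_le_card ?_).trans (Finset.card_union_le _ _)
      intro α hα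
      simp only [Finset.mem_union, Finset.mem_filter, map_mul, mul_eq_zero] at hα ⊢
      tauto
    have key : ∀ f : MvPolynomial (Fin 3) K, f.totalDegree < (R.filter fun α =>
        a α * β + b α = c β * α + e β ∧ redHom (a α) (b α) α f = 0).card →
        blueHom (c β) (e β) β f = 0 := fun f hf =>
      blueHom_eq_zero _ (fun α hα => (Finset.mem_filter.1 hα).2) hf
    have h5 := hc1 (key g (by omega))
    exact h5 (key h (by omega))
  have h6 := (Finset.card_le_card hsub).trans ((Finset.card_union_le _ _).trans
    (Nat.add_le_add_left (Finset.card_union_le _ _) _))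
  refine h6.trans ((Nat.add_le_add hbez (Nat.add_le_add hirr ihh)).trans ?_)
  rw [hdeg]
  generalize g.totalDegree = s at *
  generalize h.totalDegree = t at *
  clear * - hg1
  nlinarith [Nat.mul_le_mul_left s hg1, Nat.zero_le (s * t)]

theorem natDegree_redHom_monomial_le {K : Type*} [Field K] (a b α x : K) (m : Fin 3 →₀ ℕ) :
    (redHom a b α (monomial m x)).natDegree ≤ m 0 + m 1 := by
  rw [redHom, aeval_monomial, Finsupp.prod_fintype _ _ (by simp), Fin.prod_univ_three]
  have hl : (Polynomial.C a * Polynomial.X + Polynomial.C b).natDegree ≤ 1 :=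
    Polynomial.natDegree_linear_le
  have e1 := Polynomial.natDegree_pow_le_of_le (m 0) hl
  have e2 : (Polynomial.X ^ (m 1) : Polynomial K).natDegree ≤ m 1 :=
    Polynomial.natDegree_X_pow_le _
  refine (Polynomial.natDegree_C_mul_le _ _).trans ?_
  have e3 : ((Polynomial.C α : Polynomial K) ^ m 2).natDegree ≤ 0 := by
    rw [← Polynomial.C_pow, Polynomial.natDegree_C]
  refine Polynomial.natDegree_mul_le.trans ?_
  refine (Nat.add_le_add Polynomial.natDegree_mul_le e3).trans ?_
  rw [add_zero]
  refine (Nat.add_le_add ?_ ?_)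
  · simpa using e1
  · exact e2

theorem exists_interpolation {K : Type*} [Field K] (a b : K → K) (R : Finset K) (j : ℕ)
    (hR : R.card ≤ 4 ^ j) :
    ∃ f : MvPolynomial (Fin 3) K, f ≠ 0 ∧ f.totalDegree < 6 * 2 ^ j ∧
      ∀ α ∈ R, redHom (a α) (b α) α f = 0 := by
  classical
  set n := 2 * 2 ^ j with hn
  set μ : (Fin 3 → Fin n) → (Fin 3 →₀ ℕ) := fun i =>
    Finsupp.equivFunOnFinite.symm fun t => (i t : ℕ) with hμ
  have hμinj : Function.Injective μ := fun i i' h => by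
    ext t
    exact congrArg (fun s : Fin 3 →₀ ℕ => s t) h
  set P : ((Fin 3 → Fin n) → K) →ₗ[K] MvPolynomial (Fin 3) K :=
    ∑ i, (monomial (μ i)).comp (LinearMap.proj i) with hP
  have hPapp : ∀ x, P x = ∑ i, monomial (μ i) (x i) := fun x => by simp [hP]
  have hPcoeff : ∀ x i, coeff (μ i) (P x) = x i := fun x i => by
    rw [hPapp, coeff_sum, Finset.sum_eq_single i]
    · simp
    · intro i' _ hi'
      rw [coeff_monomial, if_neg (fun h => hi' (hμinj h))]
    · simp
  have hdeg : ∀ i, ∀ t, μ i t ≤ n - 1 := fun i t => by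
    have := (i t).2
    simp [hμ]; omega
  have hn1 : 1 ≤ n := by have := Nat.one_le_two_pow (n := j); omega
  have hPtot : ∀ x, (P x).totalDegree ≤ 3 * (n - 1) := fun x => by
    rw [hPapp]
    refine totalDegree_finsetSum_le fun i _ => (totalDegree_monomial_le _ _).trans ?_
    change (μ i).sum (fun _ x => x) ≤ _
    rw [Finsupp.sum_fintype _ _ (fun _ => rfl), Fin.sum_univ_three]
    have h0 := hdeg i 0
    have h1 := hdeg i 1
    have h2 := hdeg i 2
    omega
  have hred : ∀ x a b α, (redHom a b α (P x)).natDegree < 2 * n - 1 := fun x a b α => by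
    have : (redHom a b α (P x)).natDegree ≤ 2 * (n - 1) := by
      rw [hPapp, map_sum]
      refine Polynomial.natDegree_sum_le_of_forall_le _ _ fun i _ => ?_
      have h0 := hdeg i 0
      have h1 := hdeg i 1
      refine (natDegree_redHom_monomial_le _ _ _ _ _).trans ?_
      omega
    omega
  set L : ((Fin 3 → Fin n) → K) →ₗ[K] (R × Fin (2 * n - 1) → K) :=
    LinearMap.pi fun q => (Polynomial.lcoeff K q.2).comp
      ((redHom (a q.1) (b q.1) (q.1 : K)).toLinearMap.comp P) with hL
  have hlt : Module.finrank K (R × Fin (2 * n - 1) → K) <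
      Module.finrank K ((Fin 3 → Fin n) → K) := by
    simp only [Module.finrank_fintype_fun_eq_card, Fintype.card_prod, Fintype.card_coe,
      Fintype.card_fin, Fintype.card_fun]
    have h4 : (4 : ℕ) ^ j = 2 ^ j * 2 ^ j := by rw [← mul_pow]; norm_num
    have hp : 1 ≤ 2 ^ j := Nat.one_le_two_pow
    rw [h4] at hR
    have h5 : 2 * n - 1 < 4 * 2 ^ j := by omega
    calc R.card * (2 * n - 1) ≤ (2 ^ j * 2 ^ j) * (2 * n - 1) := Nat.mul_le_mul_right _ hR
      _ < (2 ^ j * 2 ^ j) * (4 * 2 ^ j) := by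
        apply Nat.mul_lt_mul_of_pos_left h5; positivity
      _ ≤ n ^ 3 := by rw [hn]; ring_nf; omega
  obtain ⟨x, hx, hx0⟩ := Submodule.exists_mem_ne_zero_of_ne_bot
    (LinearMap.ker_ne_bot_of_finrank_lt (f := L) hlt)
  refine ⟨P x, ?_, ?_, ?_⟩
  · intro h
    apply hx0
    ext i
    rw [← hPcoeff x i, h]; simp
  · have := hPtot x
    omega
  · intro α hα
    ext m
    rw [Polynomial.coeff_zero]
    by_cases hm : m < 2 * n - 1
    · exact congrFun (LinearMap.mem_ker.1 hx) (⟨α, hα⟩, ⟨m, hm⟩)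
    · exact Polynomial.coeff_eq_zero_of_natDegree_lt ((hred x _ _ _).trans_le (by omega))

end Surfaces

section Incidences

/-- The number of incidences `a α * β + b α = c β * α + e β` with `α ∈ R` and `β ∈ S`. -/
def incCount {K : Type*} [Field K] [DecidableEq K] (a b c e : K → K) (R S : Finset K) : ℕ :=
  ∑ β ∈ S, (R.filter fun α => a α * β + b α = c β * α + e β).card

variable {K : Type*} [Field K] [DecidableEq K] {a b c e : K → K}

theorem incCount_le_mul (R S : Finset K) : incCount a b c e R S ≤ S.card * R.card := by
  refine (Finset.sum_le_card_nsmul S _ R.card fun β _ => Finset.card_filter_le _ _).trans ?_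
  rw [smul_eq_mul]

theorem incCount_le_of_parts {S : Finset K} {m B : ℕ} (n : ℕ) :
    ∀ R : Finset K, R.card ≤ n * m →
      (∀ R' ⊆ R, R'.card ≤ m → incCount a b c e R' S ≤ B) → incCount a b c e R S ≤ n * B := by
  induction n with
  | zero =>
    intro R hR _
    have h := incCount_le_mul (a := a) (b := b) (c := c) (e := e) R S
    have : R.card = 0 := by omega
    rw [this] at h
    omega
  | succ n ih =>
    intro R hR hB
    obtain ⟨R', hR', hc⟩ := Finset.exists_subset_card_eq (Nat.min_le_right m R.card)
    have h1 := hB R' hR' (by omega)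
    have hd : (R \ R').card = R.card - R'.card := Finset.card_sdiff_of_subset hR'
    have h2 := ih (R \ R') (by rw [add_mul, one_mul] at hR; omega)
      fun R'' hs hm => hB R'' (hs.trans Finset.sdiff_subset) hm
    have h3 : incCount a b c e R S ≤ incCount a b c e R' S + incCount a b c e (R \ R') S := by
      rw [incCount, incCount, incCount, ← Finset.sum_add_distrib]
      refine Finset.sum_le_sum fun β _ => ?_
      rw [← Finset.card_union_of_disjoint
        (Finset.disjoint_filter_filter Finset.disjoint_sdiff), ← Finset.filter_union,
        Finset.union_sdiff_of_subset hR']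
    rw [add_mul]
    omega

variable {p : ℕ} [CharP K p]

theorem exists_rich_subset {R S : Finset K} {k j : ℕ}
    (hk : ∀ s t u v : K, (R.filter fun α => a α = s * α + t ∧ b α = u * α + v).card ≤ k)
    (hp : 6 * 2 ^ j ≤ p) (hR : R.card ≤ 4 ^ j) :
    ∃ S' ⊆ S, S'.card ≤ 360 * 4 ^ j ∧
      incCount a b c e R S ≤ S.card * (24 * 2 ^ j + k) + incCount a b c e R S' := by
  obtain ⟨f, hf, hd, hz⟩ := exists_interpolation a b R j hR
  have h := card_rich_le (S := S) (c := c) (e := e) hk f hf (hd.trans_le hp)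
  have hfil : ∀ β, (R.filter fun α => a α * β + b α = c β * α + e β ∧
      redHom (a α) (b α) α f = 0) = R.filter fun α => a α * β + b α = c β * α + e β := fun β =>
    Finset.filter_congr fun α hα => by simp [hz α hα]
  simp only [hfil] at h
  refine ⟨_, Finset.filter_subset _ S, h.trans ?_, ?_⟩
  · have h4 : (4 : ℕ) ^ j = 2 ^ j * 2 ^ j := by rw [← mul_pow]; norm_num
    rw [h4]
    nlinarith
  · rw [incCount, ← Finset.sum_filter_add_sum_filter_not S fun β => 4 * f.totalDegree + k <
      (R.filter fun α => a α * β + b α = c β * α + e β).card, add_comm]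
    refine Nat.add_le_add ?_ le_rfl
    refine (Finset.sum_le_card_nsmul _ _ (24 * 2 ^ j + k) fun β hβ => ?_).trans ?_
    · have := (Finset.mem_filter.1 hβ).2
      omega
    · exact Nat.mul_le_mul_right _ (Finset.card_filter_le _ _)

theorem incCount_le_balanced {R₀ : Finset K} {k : ℕ}
    (hk : ∀ s t u v : K, (R₀.filter fun α => a α = s * α + t ∧ b α = u * α + v).card ≤ k)
    (j : ℕ) : ∀ R ⊆ R₀, ∀ S : Finset K, 6 * 2 ^ j ≤ p → R.card ≤ 4 ^ j → S.card ≤ 360 * 4 ^ j →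
      incCount a b c e R S ≤ 34560 * 8 ^ j + 1440 * k * j * 4 ^ j := by
  induction j with
  | zero =>
    intro R _ S _ hR hS
    have := incCount_le_mul (a := a) (b := b) (c := c) (e := e) R S
    have := Nat.mul_le_mul hS hR
    simp at *
    omega
  | succ j ih =>
    intro R hRR S hp hR hS
    have hp' : 6 * 2 ^ j ≤ p := by rw [pow_succ] at hp; omega
    have := incCount_le_of_parts (a := a) (b := b) (c := c) (e := e) (S := S) (m := 4 ^ j)
      (B := S.card * (24 * 2 ^ j + k) + (34560 * 8 ^ j + 1440 * k * j * 4 ^ j)) 4 R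
      (by rw [pow_succ] at hR; omega) fun R' hs hm => by
        obtain ⟨S', hS', hc, hI⟩ := exists_rich_subset (S := S) (c := c) (e := e) (R := R')
          (fun s t u v => (Finset.card_le_card (Finset.filter_subset_filter _
            (hs.trans hRR))).trans (hk s t u v)) hp' hm
        exact hI.trans (Nat.add_le_add_left (ih R' (hs.trans hRR) S' hp' hm hc) _)
    refine this.trans ?_
    have h8 : (8 : ℕ) ^ j = 4 ^ j * 2 ^ j := by rw [← mul_pow]; norm_num
    have hS' : S.card * (24 * 2 ^ j + k) ≤ 360 * 4 ^ (j + 1) * (24 * 2 ^ j + k) :=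
      Nat.mul_le_mul_right _ hS
    calc 4 * (S.card * (24 * 2 ^ j + k) + (34560 * 8 ^ j + 1440 * k * j * 4 ^ j))
        ≤ 4 * (360 * 4 ^ (j + 1) * (24 * 2 ^ j + k) +
          (34560 * 8 ^ j + 1440 * k * j * 4 ^ j)) := by gcongr
      _ = 34560 * 8 ^ (j + 1) + 1440 * k * (j + 1) * 4 ^ (j + 1) := by
        rw [pow_succ, pow_succ, h8]; ring

theorem incCount_le {R S : Finset K} {k : ℕ}
    (hk : ∀ s t u v : K, (R.filter fun α => a α = s * α + t ∧ b α = u * α + v).card ≤ k)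
    (j : ℕ) (hp : 6 * 2 ^ j ≤ p) :
    incCount a b c e R S ≤ (R.card / 4 ^ j + 1) *
      (S.card * (24 * 2 ^ j + k) + (34560 * 8 ^ j + 1440 * k * j * 4 ^ j)) := by
  refine incCount_le_of_parts (m := 4 ^ j) _ R ?_ fun R' hs hm => ?_
  · have := Nat.lt_mul_div_succ R.card (pow_pos (show 0 < 4 by norm_num) j)
    rw [mul_comm]; exact this.le
  · have hk' := fun s t u v => (Finset.card_le_card (Finset.filter_subset_filter _ hs)).trans
      (hk s t u v)
    obtain ⟨S', hS', hc, hI⟩ := exists_rich_subset (S := S) (c := c) (e := e) hk' hp hm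
    exact hI.trans (Nat.add_le_add_left (incCount_le_balanced hk' j R' subset_rfl S' hp hm hc) _)

end Incidences

theorem eq_zero_of_transcendental {F K : Type*} [Field F] [Field K] [Algebra F K] {t : K}
    (ht : Transcendental F t) {u₀ u₁ u₂ u₃ u₅ u₆ : F}
    (h : algebraMap F K u₀ + algebraMap F K u₁ * t + algebraMap F K u₂ * t ^ 2 +
      algebraMap F K u₃ * t ^ 3 + algebraMap F K u₅ * t ^ 5 + algebraMap F K u₆ * t ^ 6 = 0) :
    u₀ = 0 ∧ u₁ = 0 ∧ u₂ = 0 ∧ u₃ = 0 ∧ u₅ = 0 ∧ u₆ = 0 := by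
  set q : Polynomial F := .C u₀ + .C u₁ * .X + .C u₂ * .X ^ 2 + .C u₃ * .X ^ 3 + .C u₅ * .X ^ 5 +
    .C u₆ * .X ^ 6 with hq
  have hq0 : q = 0 := by
    by_contra hne
    exact ht ⟨q, hne, by simpa [hq] using h⟩
  have hc : ∀ n, q.coeff n = 0 := fun n => by rw [hq0, Polynomial.coeff_zero]
  have h0 := hc 0
  have h1 := hc 1
  have h2 := hc 2
  have h3 := hc 3
  have h5 := hc 5
  have h6 := hc 6
  simp only [hq, Polynomial.coeff_add, Polynomial.coeff_C_mul, Polynomial.coeff_C,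
    Polynomial.coeff_X_pow, Polynomial.coeff_X] at h0 h1 h2 h3 h5 h6
  norm_num at h0 h1 h2 h3 h5 h6
  exact ⟨h0, h1, h2, h3, h5, h6⟩

/-- The number of orthogonal pairs among vectors indexed by `R` and `S` is at most the number of
incidences of the associated linear equations over an extension of the base field. -/
theorem exists_incCount_ge {F K ι : Type*} [Field F] [Field K] [Algebra F K] [DecidableEq F]
    [DecidableEq K] [DecidableEq ι] {t : K} (ht : Transcendental F t) {R S : Finset ι}
    {X Y : ι → Fin 4 → F} (hX : ∀ x ∈ R, X x 2 ≠ 0 ∨ X x 3 ≠ 0)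
    (hY : ∀ y ∈ S, Y y 0 ≠ 0 ∨ Y y 1 ≠ 0)
    (hXi : ∀ x ∈ R, ∀ x' ∈ R, (∀ i j, X x i * X x' j = X x j * X x' i) → x = x')
    (hYi : ∀ y ∈ S, ∀ y' ∈ S, (∀ i j, Y y i * Y y' j = Y y j * Y y' i) → y = y')
    {k : ℕ} (hk1 : 1 ≤ k) (hk : ∀ x ∈ R, ∀ x' ∈ R, x ≠ x' →
      ∀ T ⊆ R, (∀ z ∈ T, ∃ s u : F, ∀ i, X z i = s * X x i + u * X x' i) → T.card ≤ k) :
    ∃ (a b c e : K → K) (R' S' : Finset K), R'.card = R.card ∧ S'.card = S.card ∧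
      (∀ s t u v : K, (R'.filter fun α => a α = s * α + t ∧ b α = u * α + v).card ≤ k) ∧
      ∑ y ∈ S, (R.filter fun x => ∑ i, X x i * Y y i = 0).card = incCount a b c e R' S' := by
  have hM := FaithfulSMul.algebraMap_injective F K
  set M := algebraMap F K with hMdef
  set f1 : ι → K := fun x => M (X x 0) + t * M (X x 2) + t ^ 2 * M (X x 3) with hf1
  set f3 : ι → K := fun x => M (X x 1) + t ^ 3 * M (X x 2) + t ^ 5 * M (X x 3) with hf3
  set g0 : ι → K := fun y => M (Y y 2) - t * M (Y y 0) - t ^ 3 * M (Y y 1) with hg0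
  set g2 : ι → K := fun y => M (Y y 3) - t ^ 2 * M (Y y 0) - t ^ 5 * M (Y y 1) with hg2
  have hf3ne : ∀ x ∈ R, f3 x ≠ 0 := fun x hx h => by
    obtain ⟨-, -, -, h3, h5, -⟩ := eq_zero_of_transcendental ht (u₀ := X x 1) (u₁ := 0) (u₂ := 0)
      (u₃ := X x 2) (u₅ := X x 3) (u₆ := 0) (by simp only [map_zero]; linear_combination h)
    exact (hX x hx).elim (· h3) (· h5)
  have hg2ne : ∀ y ∈ S, g2 y ≠ 0 := fun y hy h => by
    obtain ⟨-, -, h2, -, h5, -⟩ := eq_zero_of_transcendental ht (u₀ := Y y 3) (u₁ := 0)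
      (u₂ := - Y y 0) (u₃ := 0) (u₅ := - Y y 1) (u₆ := 0)
      (by simp only [map_zero, map_neg]; linear_combination h)
    rw [neg_eq_zero] at h2 h5
    exact (hY y hy).elim (· h2) (· h5)
  have hfinj : Set.InjOn (fun x => f1 x / f3 x) R := fun x hx x' hx' h => by
    simp only at h
    rw [div_eq_div_iff (hf3ne x hx) (hf3ne x' hx')] at h
    obtain ⟨h0, h1, h2, h3, h5, h6⟩ := eq_zero_of_transcendental ht
      (u₀ := X x 0 * X x' 1 - X x 1 * X x' 0) (u₁ := X x 2 * X x' 1 - X x 1 * X x' 2)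
      (u₂ := X x 3 * X x' 1 - X x 1 * X x' 3) (u₃ := X x 0 * X x' 2 - X x 2 * X x' 0)
      (u₅ := (X x 0 * X x' 3 - X x 3 * X x' 0) - (X x 2 * X x' 3 - X x 3 * X x' 2))
      (u₆ := X x 2 * X x' 3 - X x 3 * X x' 2)
      (by simp only [map_sub, map_mul]; linear_combination h)
    rw [h6, sub_zero] at h5
    refine hXi x hx x' hx' fun i j => ?_
    fin_cases i <;> fin_cases j <;> simp <;>
    first
    | rfl
    | ring1
    | linear_combination h0
    | linear_combination -h0
    | linear_combination h1
    | linear_combination -h1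
    | linear_combination h2
    | linear_combination -h2
    | linear_combination h3
    | linear_combination -h3
    | linear_combination h5
    | linear_combination -h5
    | linear_combination h6
    | linear_combination -h6
  have hginj : Set.InjOn (fun y => g0 y / g2 y) S := fun x hx x' hx' h => by
    simp only at h
    rw [div_eq_div_iff (hg2ne x hx) (hg2ne x' hx')] at h
    obtain ⟨h0, h1, h2, h3, h5, h6⟩ := eq_zero_of_transcendental ht
      (u₀ := Y x 2 * Y x' 3 - Y x 3 * Y x' 2) (u₁ := Y x 3 * Y x' 0 - Y x 0 * Y x' 3)
      (u₂ := Y x 0 * Y x' 2 - Y x 2 * Y x' 0) (u₃ := Y x 3 * Y x' 1 - Y x 1 * Y x' 3)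
      (u₅ := (Y x 1 * Y x' 2 - Y x 2 * Y x' 1) - (Y x 0 * Y x' 1 - Y x 1 * Y x' 0))
      (u₆ := Y x 0 * Y x' 1 - Y x 1 * Y x' 0)
      (by simp only [map_sub, map_mul]; linear_combination h)
    rw [h6, sub_zero] at h5
    refine hYi x hx x' hx' fun i j => ?_
    fin_cases i <;> fin_cases j <;> simp <;>
    first
    | rfl
    | ring1
    | linear_combination h0
    | linear_combination -h0
    | linear_combination h1
    | linear_combination -h1
    | linear_combination h2
    | linear_combination -h2
    | linear_combination h3
    | linear_combination -h3
    | linear_combination h5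
    | linear_combination -h5
    | linear_combination h6
    | linear_combination -h6
  have hF : ∀ h : ι → K, ∃ a : K → K, ∀ x ∈ R, a (f1 x / f3 x) = h x := fun h => by
    rcases isEmpty_or_nonempty ι with hι | hι
    · exact ⟨0, fun x => hι.elim x⟩
    · exact ⟨fun α => h (Function.invFunOn (fun x => f1 x / f3 x) R α), fun x hx => by
        exact congrArg h (Set.InjOn.leftInvOn_invFunOn hfinj hx)⟩
  have hG : ∀ h : ι → K, ∃ a : K → K, ∀ x ∈ S, a (g0 x / g2 x) = h x := fun h => by
    rcases isEmpty_or_nonempty ι with hι | hι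
    · exact ⟨0, fun x => hι.elim x⟩
    · exact ⟨fun α => h (Function.invFunOn (fun x => g0 x / g2 x) S α), fun x hx => by
        exact congrArg h (Set.InjOn.leftInvOn_invFunOn hginj hx)⟩
  obtain ⟨a, ha⟩ := hF fun x => M (X x 2) / f3 x
  obtain ⟨b, hb⟩ := hF fun x => M (X x 3) / f3 x
  obtain ⟨c, hc⟩ := hG fun y => - M (Y y 0) / g2 y
  obtain ⟨e, he⟩ := hG fun y => - M (Y y 1) / g2 y
  refine ⟨a, b, c, e, R.image fun x => f1 x / f3 x, S.image fun y => g0 y / g2 y,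
    Finset.card_image_of_injOn hfinj, Finset.card_image_of_injOn hginj, fun s t' u v => ?_, ?_⟩
  · rw [Finset.filter_image]
    refine Finset.card_image_le.trans ?_
    set T := R.filter fun x => a (f1 x / f3 x) = s * (f1 x / f3 x) + t' ∧
      b (f1 x / f3 x) = u * (f1 x / f3 x) + v with hT
    have hTR : ∀ x ∈ T, x ∈ R := fun x hx => (Finset.mem_filter.1 hx).1
    have hTm : ∃ m n : Fin 4 → K, ∀ x ∈ T, ∀ i, M (X x i) = m i * f1 x + n i * f3 x := by
      refine ⟨![1 - t * s - t ^ 2 * u, - t ^ 3 * s - t ^ 5 * u, s, u],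
        ![- t * t' - t ^ 2 * v, 1 - t ^ 3 * t' - t ^ 5 * v, t', v], fun x hx => ?_⟩
      obtain ⟨hx1, hx2, hx3⟩ := Finset.mem_filter.1 hx
      have hne := hf3ne x hx1
      rw [ha x hx1] at hx2
      rw [hb x hx1] at hx3
      field_simp at hx2 hx3
      intro i
      fin_cases i <;> simp
      · linear_combination (-t) * hx2 - t ^ 2 * hx3
      · linear_combination (-t ^ 3) * hx2 - t ^ 5 * hx3
      · linear_combination hx2
      · linear_combination hx3
    obtain ⟨m, n, hmn⟩ := hTm
    by_cases hT1 : T.card ≤ 1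
    · exact hT1.trans hk1
    obtain ⟨x, hx, x', hx', hne⟩ := Finset.one_lt_card.1 (not_le.1 hT1)
    refine hk x (hTR x hx) x' (hTR x' hx') hne T hTR fun z hz => ?_
    have : ∃ i j, X x i * X x' j - X x j * X x' i ≠ 0 := by
      by_contra! hcon
      exact hne (hXi x (hTR x hx) x' (hTR x' hx') fun i j => sub_eq_zero.1 (hcon i j))
    obtain ⟨i, j, hij⟩ := this
    refine ⟨(X z i * X x' j - X z j * X x' i) / (X x i * X x' j - X x j * X x' i),
      (X x i * X z j - X x j * X z i) / (X x i * X x' j - X x j * X x' i), fun l => ?_⟩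
    rw [div_mul_eq_mul_div, div_mul_eq_mul_div, ← add_div, eq_div_iff hij]
    apply hM
    simp only [map_add, map_sub, map_mul, hmn z hz, hmn x hx, hmn x' hx']
    ring
  · rw [incCount, Finset.sum_image hginj]
    refine Finset.sum_congr rfl fun y hy => ?_
    rw [Finset.filter_image, Finset.card_image_of_injOn
      (hfinj.mono (by exact_mod_cast Finset.filter_subset _ _))]
    refine congrArg _ (Finset.filter_congr fun x hx => ?_)
    rw [ha x hx, hb x hx, hc y hy, he y hy]
    have h1 := hf3ne x hx
    have h2 := hg2ne y hy
    rw [Fin.sum_univ_four, ← hM.eq_iff]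
    simp only [map_add, map_mul, map_zero]
    have key : M (X x 2) / f3 x * (g0 y / g2 y) + M (X x 3) / f3 x -
        (- M (Y y 0) / g2 y * (f1 x / f3 x) + - M (Y y 1) / g2 y) =
        (M (X x 0) * M (Y y 0) + M (X x 1) * M (Y y 1) + M (X x 2) * M (Y y 2) +
          M (X x 3) * M (Y y 3)) / (f3 x * g2 y) := by
      field_simp
      simp only [hf1, hf3, hg0, hg2]
      ring
    rw [← sub_eq_zero (a := _ + _) (b := _ + _), key, div_eq_zero_iff,
      or_iff_left (mul_ne_zero h1 h2)]

theorem card_orthogonal_le {p : ℕ} [Fact p.Prime] {ι : Type*} [DecidableEq ι] {R S : Finset ι}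
    {X Y : ι → Fin 4 → ZMod p} (hX : ∀ x ∈ R, X x 2 ≠ 0 ∨ X x 3 ≠ 0)
    (hY : ∀ y ∈ S, Y y 0 ≠ 0 ∨ Y y 1 ≠ 0)
    (hXi : ∀ x ∈ R, ∀ x' ∈ R, (∀ i j, X x i * X x' j = X x j * X x' i) → x = x')
    (hYi : ∀ y ∈ S, ∀ y' ∈ S, (∀ i j, Y y i * Y y' j = Y y j * Y y' i) → y = y')
    {k : ℕ} (hk1 : 1 ≤ k) (hk : ∀ x ∈ R, ∀ x' ∈ R, x ≠ x' →
      ∀ T ⊆ R, (∀ z ∈ T, ∃ s u : ZMod p, ∀ i, X z i = s * X x i + u * X x' i) → T.card ≤ k)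
    (j : ℕ) (hp : 6 * 2 ^ j ≤ p) :
    ∑ y ∈ S, (R.filter fun x => ∑ i, X x i * Y y i = 0).card ≤ (R.card / 4 ^ j + 1) *
      (S.card * (24 * 2 ^ j + k) + (34560 * 8 ^ j + 1440 * k * j * 4 ^ j)) := by
  classical
  obtain ⟨a, b, c, e, R', S', hR, hS, hk', h⟩ := exists_incCount_ge
    (RatFunc.transcendental_X (K := ZMod p)) hX hY hXi hYi hk1 hk
  have : CharP (RatFunc (ZMod p)) p := charP_of_injective_algebraMap
    (FaithfulSMul.algebraMap_injective (ZMod p) (RatFunc (ZMod p))) p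
  rw [h, ← hR, ← hS]
  exact incCount_le hk' j hp

section Anisotropic

variable {F : Type*} [Field F]

theorem eq_zero_of_complex_mul_eq_zero (hF : ∀ x y : F, x ^ 2 + y ^ 2 = 0 → x = 0 ∧ y = 0)
    {g₁ g₂ x y : F} (hg : g₁ ≠ 0 ∨ g₂ ≠ 0) (h₁ : x * g₁ - y * g₂ = 0)
    (h₂ : x * g₂ + y * g₁ = 0) : x = 0 ∧ y = 0 := by
  have h : (x ^ 2 + y ^ 2) * (g₁ ^ 2 + g₂ ^ 2) = 0 := by
    linear_combination (x * g₁ - y * g₂) * h₁ + (x * g₂ + y * g₁) * h₂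
  rcases mul_eq_zero.1 h with h | h
  · exact hF _ _ h
  · have := hF _ _ h
    tauto

/-- For vectors `e` and `s` of the same nonzero length, there is a nonzero complex number `g`
such that `conj (g * s) = e * g`. -/
theorem exists_halfTurn {r e₁ e₂ s₁ s₂ : F} (hr : r ≠ 0) (he : e₁ ^ 2 + e₂ ^ 2 = r)
    (hs : s₁ ^ 2 + s₂ ^ 2 = r) :
    ∃ g : F × F, (g.1 ≠ 0 ∨ g.2 ≠ 0) ∧ g.1 * s₁ - g.2 * s₂ = e₁ * g.1 - e₂ * g.2 ∧
      g.1 * s₂ + g.2 * s₁ = -(e₁ * g.2 + e₂ * g.1) := by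
  by_cases h : r + e₁ * s₁ - e₂ * s₂ = 0 ∧ e₁ * s₂ + e₂ * s₁ = 0
  · refine ⟨(0, 1), Or.inr one_ne_zero, ?_, ?_⟩
    · have : r * (s₂ - e₂) = 0 := by
        linear_combination (-e₂) * h.1 + e₁ * h.2 + s₂ * (-he)
      rcases mul_eq_zero.1 this with h' | h'
      · exact absurd h' hr
      · linear_combination -h'
    · have : r * (s₁ + e₁) = 0 := by
        linear_combination e₁ * h.1 + e₂ * h.2 - s₁ * he
      rcases mul_eq_zero.1 this with h' | h'
      · exact absurd h' hr
      · linear_combination h'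
  · refine ⟨(r + e₁ * s₁ - e₂ * s₂, -(e₁ * s₂ + e₂ * s₁)), ?_, ?_, ?_⟩
    · rw [neg_ne_zero]; tauto
    · linear_combination e₁ * hs - s₁ * he
    · linear_combination (-e₂) * hs - s₂ * he

/-- A one-parameter family of points `U z`, where `U z * g z` and `g z` are real combinations of
their values at two members of the family, contains at most two members at any given distance
from a fixed member. -/
theorem card_le_of_pencil (hF : ∀ x y : F, x ^ 2 + y ^ 2 = 0 → x = 0 ∧ y = 0)
    {ι : Type*} [DecidableEq F] {T : Finset ι} {U g : ι → F × F} {x x' : ι}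
    (hg : ∀ z ∈ T, (g z).1 ≠ 0 ∨ (g z).2 ≠ 0) (hgx : (g x).1 ≠ 0 ∨ (g x).2 ≠ 0)
    (hgx' : (g x').1 ≠ 0 ∨ (g x').2 ≠ 0) (hU : U x ≠ U x')
    (hinj : ∀ z ∈ T, ∀ z' ∈ T, ∀ l : F, g z = (l * (g z').1, l * (g z').2) → U z = U z' → z = z')
    (hT : ∀ z ∈ T, ∃ s u : F, (g z).1 = s * (g x).1 + u * (g x').1 ∧
      (g z).2 = s * (g x).2 + u * (g x').2 ∧
      (U z).1 * (g z).1 - (U z).2 * (g z).2 = s * ((U x).1 * (g x).1 - (U x).2 * (g x).2) +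
        u * ((U x').1 * (g x').1 - (U x').2 * (g x').2) ∧
      (U z).1 * (g z).2 + (U z).2 * (g z).1 = s * ((U x).1 * (g x).2 + (U x).2 * (g x).1) +
        u * ((U x').1 * (g x').2 + (U x').2 * (g x').1))
    (D : Finset F) (hD : ∀ z ∈ T, ((U z).1 - (U x).1) ^ 2 + ((U z).2 - (U x).2) ^ 2 ∈ D) :
    T.card ≤ 2 * D.card := by
  classical
  refine Finset.card_le_mul_card_image_of_maps_to hD 2 fun t ht => ?_
  by_contra! hlt
  obtain ⟨z₁, z₂, z₃, h₁, h₂, h₃, h₁₂, h₁₃, h₂₃⟩ := Finset.two_lt_card_iff.1 hlt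
  rw [mem_filter] at h₁ h₂ h₃
  have hsq : ∀ {y : F × F}, (y.1 ≠ 0 ∨ y.2 ≠ 0) → y.1 ^ 2 + y.2 ^ 2 ≠ 0 := fun hy h => by
    have := hF _ _ h; tauto
  set q : F := ((U x').1 - (U x).1) ^ 2 + ((U x').2 - (U x).2) ^ 2 with hq
  have hqne : q ≠ 0 := fun h => hU (by
    have := hF _ _ h
    exact Prod.ext (sub_eq_zero.1 this.1).symm (sub_eq_zero.1 this.2).symm)
  have key : ∀ z ∈ T, ∀ s u : F, (g z).1 = s * (g x).1 + u * (g x').1 →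
      (g z).2 = s * (g x).2 + u * (g x').2 →
      (U z).1 * (g z).1 - (U z).2 * (g z).2 = s * ((U x).1 * (g x).1 - (U x).2 * (g x).2) +
        u * ((U x').1 * (g x').1 - (U x').2 * (g x').2) →
      (U z).1 * (g z).2 + (U z).2 * (g z).1 = s * ((U x).1 * (g x).2 + (U x).2 * (g x).1) +
        u * ((U x').1 * (g x').2 + (U x').2 * (g x').1) →
      (((U z).1 - (U x).1) ^ 2 + ((U z).2 - (U x).2) ^ 2) * ((g z).1 ^ 2 + (g z).2 ^ 2) =
        u ^ 2 * (q * ((g x').1 ^ 2 + (g x').2 ^ 2)) := by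
    intro z hz s u e1 e2 e3 e4
    have k1 : ((U z).1 - (U x).1) * (g z).1 - ((U z).2 - (U x).2) * (g z).2 =
        u * (((U x').1 - (U x).1) * (g x').1 - ((U x').2 - (U x).2) * (g x').2) := by
      linear_combination e3 - (U x).1 * e1 + (U x).2 * e2
    have k2 : ((U z).1 - (U x).1) * (g z).2 + ((U z).2 - (U x).2) * (g z).1 =
        u * (((U x').1 - (U x).1) * (g x').2 + ((U x').2 - (U x).2) * (g x').1) := by
      linear_combination e4 - (U x).1 * e2 - (U x).2 * e1
    calc _ = (((U z).1 - (U x).1) * (g z).1 - ((U z).2 - (U x).2) * (g z).2) ^ 2 +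
        (((U z).1 - (U x).1) * (g z).2 + ((U z).2 - (U x).2) * (g z).1) ^ 2 := by ring
      _ = _ := by rw [k1, k2, hq]; ring
  by_cases ht0 : t = 0
  · have hz : ∀ z ∈ T, ((U z).1 - (U x).1) ^ 2 + ((U z).2 - (U x).2) ^ 2 = t →
        U z = U x ∧ ∃ s, s ≠ 0 ∧ g z = (s * (g x).1, s * (g x).2) := by
      intro z hz h
      obtain ⟨s, u, e1, e2, e3, e4⟩ := hT z hz
      have h5 := key z hz s u e1 e2 e3 e4
      rw [h, ht0, zero_mul, eq_comm, mul_eq_zero, or_iff_left (mul_ne_zero hqne (hsq hgx'))] at h5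
      have hu : u = 0 := by simpa using h5
      subst hu
      rw [ht0] at h
      have h6 := hF _ _ h
      refine ⟨Prod.ext (sub_eq_zero.1 h6.1) (sub_eq_zero.1 h6.2), s, ?_,
        Prod.ext (by simpa using e1) (by simpa using e2)⟩
      rintro rfl
      rcases hg z hz with h | h
      · exact h (by simpa using e1)
      · exact h (by simpa using e2)
    obtain ⟨k1, s1, hs1, k1'⟩ := hz z₁ h₁.1 h₁.2
    obtain ⟨k2, s2, hs2, k2'⟩ := hz z₂ h₂.1 h₂.2
    refine h₁₂ (hinj z₁ h₁.1 z₂ h₂.1 (s1 / s2) ?_ (k1.trans k2.symm))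
    rw [k1', k2']
    ext <;> simp <;> field_simp
  · have hz : ∀ z ∈ T, ((U z).1 - (U x).1) ^ 2 + ((U z).2 - (U x).2) ^ 2 = t →
        ∃ u m, u ≠ 0 ∧ (g z).1 = u * (m * (g x).1 + (g x').1) ∧
        (g z).2 = u * (m * (g x).2 + (g x').2) ∧
        (U z).1 * (g z).1 - (U z).2 * (g z).2 = u * (m * ((U x).1 * (g x).1 - (U x).2 * (g x).2) +
          ((U x').1 * (g x').1 - (U x').2 * (g x').2)) ∧
        (U z).1 * (g z).2 + (U z).2 * (g z).1 = u * (m * ((U x).1 * (g x).2 + (U x).2 * (g x).1) +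
          ((U x').1 * (g x').2 + (U x').2 * (g x').1)) ∧
        t * ((m * (g x).1 + (g x').1) ^ 2 + (m * (g x).2 + (g x').2) ^ 2) =
          q * ((g x').1 ^ 2 + (g x').2 ^ 2) := by
      intro z hz h
      obtain ⟨s, u, e1, e2, e3, e4⟩ := hT z hz
      have h5 := key z hz s u e1 e2 e3 e4
      rw [h] at h5
      have hu : u ≠ 0 := by
        rintro rfl
        have := mul_ne_zero ht0 (hsq (hg z hz))
        apply this
        rw [h5]; ring
      refine ⟨u, s / u, hu, ?_, ?_, ?_, ?_, ?_⟩
      · rw [e1]; field_simp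
      · rw [e2]; field_simp
      · rw [e3]; field_simp
      · rw [e4]; field_simp
      · rw [e1, e2] at h5
        field_simp
        linear_combination h5
    obtain ⟨u1, m1, hu1, a1, b1, c1, d1, q1⟩ := hz z₁ h₁.1 h₁.2
    obtain ⟨u2, m2, hu2, a2, b2, c2, d2, q2⟩ := hz z₂ h₂.1 h₂.2
    obtain ⟨u3, m3, hu3, a3, b3, c3, d3, q3⟩ := hz z₃ h₃.1 h₃.2
    have hm : ∀ z ∈ T, ∀ z' ∈ T, ∀ u u' m : F, u' ≠ 0 → z ≠ z' →
        (g z).1 = u * (m * (g x).1 + (g x').1) →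
        (g z).2 = u * (m * (g x).2 + (g x').2) →
        (U z).1 * (g z).1 - (U z).2 * (g z).2 = u * (m * ((U x).1 * (g x).1 - (U x).2 * (g x).2) +
          ((U x').1 * (g x').1 - (U x').2 * (g x').2)) →
        (U z).1 * (g z).2 + (U z).2 * (g z).1 = u * (m * ((U x).1 * (g x).2 + (U x).2 * (g x).1) +
          ((U x').1 * (g x').2 + (U x').2 * (g x').1)) →
        (g z').1 = u' * (m * (g x).1 + (g x').1) →
        (g z').2 = u' * (m * (g x).2 + (g x').2) →
        (U z').1 * (g z').1 - (U z').2 * (g z').2 =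
          u' * (m * ((U x).1 * (g x).1 - (U x).2 * (g x).2) +
          ((U x').1 * (g x').1 - (U x').2 * (g x').2)) →
        (U z').1 * (g z').2 + (U z').2 * (g z').1 =
          u' * (m * ((U x).1 * (g x).2 + (U x).2 * (g x).1) +
          ((U x').1 * (g x').2 + (U x').2 * (g x').1)) → False := by
      intro z hz z' hz' u u' m hu' hne a b c d a' b' c' d'
      have f1 : (g z).1 = u / u' * (g z').1 := by rw [a, a']; field_simp
      have f2 : (g z).2 = u / u' * (g z').2 := by rw [b, b']; field_simp
      have hl : u / u' ≠ 0 := by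
        intro h0
        rw [h0, zero_mul] at f1 f2
        rcases hg z hz with h | h
        exacts [h f1, h f2]
      refine hne (hinj z hz z' hz' (u / u') (Prod.ext f1 f2) ?_)
      have f3 : (U z).1 * (g z).1 - (U z).2 * (g z).2 =
          u / u' * ((U z').1 * (g z').1 - (U z').2 * (g z').2) := by
        rw [c, c']; field_simp
      have f4 : (U z).1 * (g z).2 + (U z).2 * (g z).1 =
          u / u' * ((U z').1 * (g z').2 + (U z').2 * (g z').1) := by
        rw [d, d']; field_simp
      have := eq_zero_of_complex_mul_eq_zero hF (hg z hz) (x := (U z).1 - (U z').1)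
        (y := (U z).2 - (U z').2)
        (by linear_combination f3 - (U z').1 * f1 + (U z').2 * f2)
        (by linear_combination f4 - (U z').1 * f2 - (U z').2 * f1)
      exact Prod.ext (sub_eq_zero.1 this.1) (sub_eq_zero.1 this.2)
    have hm12 : m1 - m2 ≠ 0 := sub_ne_zero.2 fun h => by
      subst h; exact hm _ h₁.1 _ h₂.1 _ _ _ hu2 h₁₂ a1 b1 c1 d1 a2 b2 c2 d2
    have hm13 : m1 - m3 ≠ 0 := sub_ne_zero.2 fun h => by
      subst h; exact hm _ h₁.1 _ h₃.1 _ _ _ hu3 h₁₃ a1 b1 c1 d1 a3 b3 c3 d3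
    have hm23 : m2 - m3 ≠ 0 := sub_ne_zero.2 fun h => by
      subst h; exact hm _ h₂.1 _ h₃.1 _ _ _ hu3 h₂₃ a2 b2 c2 d2 a3 b3 c3 d3
    have : t * ((g x).1 ^ 2 + (g x).2 ^ 2) * ((m1 - m2) * (m1 - m3) * (m2 - m3)) = 0 := by
      linear_combination (m2 - m3) * q1 - (m1 - m3) * q2 + (m1 - m2) * q3
    exact mul_ne_zero (mul_ne_zero ht0 (hsq hgx)) (mul_ne_zero (mul_ne_zero hm12 hm13) hm23) this

end Anisotropic

/-- The ordered pairs of points of `E` at distance `r`. -/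
def pairsAt {p : ℕ} (E : Finset (Pt p)) (r : ZMod p) : Finset (Pt p × Pt p) :=
  (E ×ˢ E).filter fun q => dist2 q.1 q.2 = r

/-- The sum of `b - d` and `a - c` is orthogonal to `b - a`, and their difference is parallel to
`b - a`: this holds when one reflection exchanges `a` with `b` and `c` with `d`. -/
def IsMirror {p : ℕ} (a b c d : Pt p) : Prop :=
  ((b.1 - d.1) + (a.1 - c.1)) * (b.1 - a.1) + ((b.2 - d.2) + (a.2 - c.2)) * (b.2 - a.2) = 0 ∧
  ((b.2 - d.2) - (a.2 - c.2)) * (b.1 - a.1) - ((b.1 - d.1) - (a.1 - c.1)) * (b.2 - a.2) = 0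

instance {p : ℕ} (a b c d : Pt p) : Decidable (IsMirror a b c d) :=
  inferInstanceAs (Decidable (_ ∧ _))

theorem exists_smul_of_minors {F : Type*} [Field F] {v v' : Fin 4 → F} {k : Fin 4} (hk : v k ≠ 0)
    (h : ∀ i j, v i * v' j = v j * v' i) : ∃ l, ∀ i, v' i = l * v i :=
  ⟨v' k / v k, fun i => by
    have := h k i
    field_simp
    linear_combination this⟩

theorem distSet_mem {p : ℕ} {E : Finset (Pt p)} {x y : Pt p} (hx : x ∈ E) (hy : y ∈ E) :
    dist2 x y ∈ distSet E :=
  mem_image.2 ⟨(x, y), mem_product.2 ⟨hx, hy⟩, rfl⟩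

theorem card_isMirror_le {p : ℕ} [Fact p.Prime]
    (hF : ∀ x y : ZMod p, x ^ 2 + y ^ 2 = 0 → x = 0 ∧ y = 0) (E : Finset (Pt p)) {r : ZMod p}
    (hr : r ≠ 0) (j : ℕ) (hp : 6 * 2 ^ j ≤ p) :
    ∑ y ∈ pairsAt E r, ((pairsAt E r).filter fun x => IsMirror x.1 y.1 x.2 y.2).card ≤
      ((pairsAt E r).card / 4 ^ j + 1) * ((pairsAt E r).card *
        (24 * 2 ^ j + 2 * (distSet E).card) +
        (34560 * 8 ^ j + 1440 * (2 * (distSet E).card) * j * 4 ^ j)) := by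
  classical
  rcases (pairsAt E r).eq_empty_or_nonempty with h0 | ⟨q₀, hq₀⟩
  · simp [h0]
  have hmem : ∀ {q}, q ∈ pairsAt E r → q.1 ∈ E ∧ q.2 ∈ E ∧
      (q.1.1 - q.2.1) ^ 2 + (q.1.2 - q.2.2) ^ 2 = r := fun {q} hq => by
    rw [pairsAt, mem_filter, mem_product] at hq
    exact ⟨hq.1.1, hq.1.2, hq.2⟩
  obtain ⟨s₁, s₂, hs⟩ : ∃ s₁ s₂ : ZMod p, s₁ ^ 2 + s₂ ^ 2 = r := ⟨_, _, (hmem hq₀).2.2⟩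
  have hsne : s₁ ≠ 0 ∨ s₂ ≠ 0 := by
    by_contra! h
    rw [h.1, h.2] at hs
    exact hr (by rw [← hs]; ring)
  have hG : ∀ q : Pt p × Pt p, ∃ g : ZMod p × ZMod p, q ∈ pairsAt E r →
      (g.1 ≠ 0 ∨ g.2 ≠ 0) ∧
      g.1 * s₁ - g.2 * s₂ = (q.1.1 - q.2.1) * g.1 - (q.1.2 - q.2.2) * g.2 ∧
      g.1 * s₂ + g.2 * s₁ = -((q.1.1 - q.2.1) * g.2 + (q.1.2 - q.2.2) * g.1) := fun q => by
    by_cases hq : q ∈ pairsAt E r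
    · obtain ⟨g, hg⟩ := exists_halfTurn hr (hmem hq).2.2 hs
      exact ⟨g, fun _ => hg⟩
    · exact ⟨0, fun h => absurd h hq⟩
  choose g hg using hG
  have hdiff : ∀ q ∈ pairsAt E r, ∀ q' ∈ pairsAt E r, ∀ l, g q = (l * (g q').1, l * (g q').2) →
      q.1.1 - q.2.1 = q'.1.1 - q'.2.1 ∧ q.1.2 - q.2.2 = q'.1.2 - q'.2.2 := by
    intro q hq q' hq' l h
    obtain ⟨h1, h2, h3⟩ := hg q hq
    obtain ⟨h1', h2', h3'⟩ := hg q' hq'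
    have e1 : (g q).1 = l * (g q').1 := congrArg Prod.fst h
    have e2 : (g q).2 = l * (g q').2 := congrArg Prod.snd h
    have := eq_zero_of_complex_mul_eq_zero hF h1
      (x := (q.1.1 - q.2.1) - (q'.1.1 - q'.2.1)) (y := (q.1.2 - q.2.2) - (q'.1.2 - q'.2.2))
      (by linear_combination -h2 + l * h2' + (s₁ - (q'.1.1 - q'.2.1)) * e1 -
            (s₂ - (q'.1.2 - q'.2.2)) * e2)
      (by linear_combination h3 - l * h3' - (s₂ + (q'.1.2 - q'.2.2)) * e1 -
            (s₁ + (q'.1.1 - q'.2.1)) * e2)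
    exact ⟨sub_eq_zero.1 this.1, sub_eq_zero.1 this.2⟩
  have hinj₁ : ∀ q ∈ pairsAt E r, ∀ q' ∈ pairsAt E r, ∀ l, g q = (l * (g q').1, l * (g q').2) →
      q.1 = q'.1 → q = q' := fun q hq q' hq' l h h1 => by
    have := hdiff q hq q' hq' l h
    refine Prod.ext h1 (Prod.ext ?_ ?_)
    · rw [h1] at this; linear_combination -this.1
    · rw [h1] at this; linear_combination -this.2
  have hinj₂ : ∀ q ∈ pairsAt E r, ∀ q' ∈ pairsAt E r, ∀ l, g q = (l * (g q').1, l * (g q').2) →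
      q.2 = q'.2 → q = q' := fun q hq q' hq' l h h1 => by
    have := hdiff q hq q' hq' l h
    refine Prod.ext (Prod.ext ?_ ?_) h1
    · rw [h1] at this; linear_combination this.1
    · rw [h1] at this; linear_combination this.2
  set X : Pt p × Pt p → Fin 4 → ZMod p := fun q =>
    ![q.1.1 * (g q).1 - q.1.2 * (g q).2, q.1.1 * (g q).2 + q.1.2 * (g q).1, (g q).1, (g q).2]
    with hX
  set o₁ : Pt p × Pt p → ZMod p := fun q => (g q).1 * s₁ - (g q).2 * s₂ with ho₁
  set o₂ : Pt p × Pt p → ZMod p := fun q => (g q).1 * s₂ + (g q).2 * s₁ with ho₂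
  set Y : Pt p × Pt p → Fin 4 → ZMod p := fun q =>
    ![o₁ q, - o₂ q, -(q.1.1 * o₁ q - q.1.2 * o₂ q), q.1.1 * o₂ q + q.1.2 * o₁ q] with hY
  have hone : ∀ q ∈ pairsAt E r, o₁ q ≠ 0 ∨ o₂ q ≠ 0 := fun q hq => by
    by_contra! h
    have := eq_zero_of_complex_mul_eq_zero hF hsne h.1 h.2
    have := (hg q hq).1
    tauto
  have h2 : (2 : ZMod p) ≠ 0 := fun h => by
    have := hF 1 1 (by linear_combination h)
    exact one_ne_zero this.1
  have hXY : ∀ x ∈ pairsAt E r, ∀ y ∈ pairsAt E r, IsMirror x.1 y.1 x.2 y.2 →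
      ∑ i, X x i * Y y i = 0 := fun x hx y hy ⟨m1, m2⟩ => by
    obtain ⟨-, e1, e2⟩ := hg x hx
    obtain ⟨-, f1, f2⟩ := hg y hy
    refine (mul_eq_zero.1 ?_).resolve_left h2
    simp only [hX, hY, ho₁, ho₂, Fin.sum_univ_four, Matrix.cons_val]
    linear_combination
      (-((y.1.1 - x.1.1) * (g y).1 - (y.1.2 - x.1.2) * (g y).2)) * e1 +
      ((y.1.1 - x.1.1) * (g y).2 + (y.1.2 - x.1.2) * (g y).1) * e2 -
      ((y.1.1 - x.1.1) * (g x).1 - (y.1.2 - x.1.2) * (g x).2) * f1 +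
      ((y.1.1 - x.1.1) * (g x).2 + (y.1.2 - x.1.2) * (g x).1) * f2 -
      ((g x).1 * (g y).1 + (g x).2 * (g y).2) * m1 +
      ((g x).1 * (g y).2 - (g x).2 * (g y).1) * m2
  refine (Finset.sum_le_sum fun y hy => Finset.card_le_card (t := (pairsAt E r).filter
    fun x => ∑ i, X x i * Y y i = 0) fun x hx => ?_).trans
    (card_orthogonal_le (X := X) (Y := Y) ?_ ?_ ?_ ?_ ?_ ?_ j hp)
  · rw [mem_filter] at hx ⊢
    exact ⟨hx.1, hXY x hx.1 y hy hx.2⟩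
  · exact fun x hx => (hg x hx).1
  · intro y hy
    have := hone y hy
    simpa [hY] using this
  · intro x hx x' hx' h
    obtain ⟨l, hl⟩ : ∃ l, ∀ i, X x i = l * X x' i := by
      rcases (hg x' hx').1 with h' | h'
      · exact exists_smul_of_minors (k := 2) h' fun i j => by rw [mul_comm, ← h, mul_comm]
      · exact exists_smul_of_minors (k := 3) h' fun i j => by rw [mul_comm, ← h, mul_comm]
    have l0 := hl 0
    have l1 := hl 1
    have l2 := hl 2
    have l3 := hl 3
    simp only [hX, Matrix.cons_val] at l0 l1 l2 l3
    refine hinj₁ x hx x' hx' l (Prod.ext l2 l3) ?_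
    have := eq_zero_of_complex_mul_eq_zero hF (hg x hx).1 (x := x.1.1 - x'.1.1)
      (y := x.1.2 - x'.1.2) (by linear_combination l0 - x'.1.1 * l2 + x'.1.2 * l3)
      (by linear_combination l1 - x'.1.1 * l3 - x'.1.2 * l2)
    exact Prod.ext (sub_eq_zero.1 this.1) (sub_eq_zero.1 this.2)
  · intro x hx x' hx' h
    obtain ⟨l, hl⟩ : ∃ l, ∀ i, Y x i = l * Y x' i := by
      rcases hone x' hx' with h' | h'
      · exact exists_smul_of_minors (k := 0) h' fun i j => by rw [mul_comm, ← h, mul_comm]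
      · exact exists_smul_of_minors (k := 1) (neg_ne_zero.2 h')
          fun i j => by rw [mul_comm, ← h, mul_comm]
    have l0 := hl 0
    have l1 := hl 1
    have l2 := hl 2
    have l3 := hl 3
    simp only [hY, Matrix.cons_val] at l0 l1 l2 l3
    have hgl := eq_zero_of_complex_mul_eq_zero hF hsne (x := (g x).1 - l * (g x').1)
      (y := (g x).2 - l * (g x').2) (by simp only [ho₁] at l0; linear_combination l0)
      (by simp only [ho₂] at l1; linear_combination -l1)
    refine hinj₁ x hx x' hx' l (Prod.ext (sub_eq_zero.1 hgl.1) (sub_eq_zero.1 hgl.2)) ?_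
    have := eq_zero_of_complex_mul_eq_zero hF (hone x hx) (x := x.1.1 - x'.1.1)
      (y := x.1.2 - x'.1.2) (by linear_combination -l2 - x'.1.1 * l0 - x'.1.2 * l1)
      (by linear_combination l3 + x'.1.1 * l1 - x'.1.2 * l0)
    exact Prod.ext (sub_eq_zero.1 this.1) (sub_eq_zero.1 this.2)
  · have : 0 < (distSet E).card := card_pos.2 ⟨_, distSet_mem (hmem hq₀).1 (hmem hq₀).1⟩
    omega
  · intro x hx x' hx' hne T hT hcomb
    have hT' : ∀ z ∈ T, z ∈ pairsAt E r := fun z hz => hT hz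
    by_cases h1 : x.1 = x'.1
    · have h2 : x.2 ≠ x'.2 := fun h => hne (Prod.ext h1 h)
      refine card_le_of_pencil hF (U := Prod.snd) (g := g) (fun z hz => (hg z (hT' z hz)).1)
        (hg x hx).1 (hg x' hx').1 h2 (fun z hz z' hz' => hinj₂ z (hT' z hz) z' (hT' z' hz'))
        (fun z hz => ?_) _ fun z hz => distSet_mem (hmem (hT' z hz)).2.1 (hmem hx).2.1
      obtain ⟨s, u, hsu⟩ := hcomb z hz
      have l0 := hsu 0
      have l1 := hsu 1
      have l2 := hsu 2
      have l3 := hsu 3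
      simp only [hX, Matrix.cons_val] at l0 l1 l2 l3
      obtain ⟨-, a1, a2⟩ := hg z (hT' z hz)
      obtain ⟨-, b1, b2⟩ := hg x hx
      obtain ⟨-, c1, c2⟩ := hg x' hx'
      refine ⟨s, u, l2, l3, ?_, ?_⟩
      · linear_combination l0 + a1 - s * b1 - u * c1 - s₁ * l2 + s₂ * l3
      · linear_combination l1 - a2 + s * b2 + u * c2 + s₁ * l3 + s₂ * l2
    · refine card_le_of_pencil hF (U := Prod.fst) (g := g) (fun z hz => (hg z (hT' z hz)).1)
        (hg x hx).1 (hg x' hx').1 h1 (fun z hz z' hz' => hinj₁ z (hT' z hz) z' (hT' z' hz'))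
        (fun z hz => ?_) _ fun z hz => distSet_mem (hmem (hT' z hz)).1 (hmem hx).1
      obtain ⟨s, u, hsu⟩ := hcomb z hz
      exact ⟨s, u, hsu 2, hsu 3, hsu 0, hsu 1⟩

theorem sum_incidences_le {α β κ : Type*} [DecidableEq β] [DecidableEq κ] (P : Finset α)
    (E : Finset β) (key : α → κ) (On : β → κ → Prop) [∀ z l, Decidable (On z l)]
    (h : ∀ l ∈ P.image key, ∀ l' ∈ P.image key, ∀ z z', z ≠ z' → On z l → On z' l →
      On z l' → On z' l' → l = l') :
    ∃ U, ∑ q ∈ P, (E.filter fun z => On z (key q)).card ≤ P.card + U ∧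
      U ^ 2 ≤ (∑ q ∈ P, (P.filter fun q' => key q' = key q).card) * E.card ^ 2 := by
  set i : κ → ℕ := fun l => (E.filter fun z => On z l).card with hi
  set w : κ → ℕ := fun l => (P.filter fun q' => key q' = l).card with hw
  have hfib : ∀ f : κ → ℕ, ∑ q ∈ P, f (key q) = ∑ l ∈ P.image key, w l * f l := fun f => by
    rw [← sum_fiberwise_of_maps_to (g := key) (t := P.image key)
      (fun q hq => mem_image_of_mem key hq)]
    refine sum_congr rfl fun l _ => ?_
    rw [sum_congr rfl (g := fun _ => f l) fun q hq => by rw [(mem_filter.1 hq).2], sum_const,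
      smul_eq_mul]
  refine ⟨∑ q ∈ P, (i (key q) - 1), ?_, ?_⟩
  · rw [card_eq_sum_ones, ← sum_add_distrib]
    exact sum_le_sum fun q _ => by simp only [hi]; omega
  · rw [hfib fun l => i l - 1, hfib w]
    refine (sum_mul_sq_le_sq_mul_sq _ _ _).trans ?_
    refine Nat.mul_le_mul (sum_le_sum fun l _ => by rw [sq]) ?_
    have hdis : Set.PairwiseDisjoint (P.image key : Set κ)
        (fun l => (E.filter fun z => On z l).offDiag) := by
      intro l hl l' hl' hne
      rw [Function.onFun, Finset.disjoint_left]
      rintro ⟨z, z'⟩ h1 h2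
      simp only [mem_offDiag, mem_filter] at h1 h2
      exact hne (h l hl l' hl' z z' h1.2.2 h1.1.2 h1.2.1.2 h2.1.2 h2.2.1.2)
    calc ∑ l ∈ P.image key, (i l - 1) ^ 2
        ≤ ∑ l ∈ P.image key, ((E.filter fun z => On z l).offDiag).card := by
          refine sum_le_sum fun l _ => ?_
          rw [offDiag_card, sq, ← Nat.sub_one_mul]
          exact Nat.mul_le_mul_left _ (Nat.sub_le _ _)
      _ = ((P.image key).biUnion fun l => (E.filter fun z => On z l).offDiag).card :=
          (card_biUnion hdis).symm
      _ ≤ (E ×ˢ E).card := card_le_card fun q hq => by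
          rw [mem_biUnion] at hq
          obtain ⟨l, _, hq⟩ := hq
          simp only [mem_offDiag, mem_filter] at hq
          exact mem_product.2 ⟨hq.1.1, hq.2.1.1⟩
      _ = E.card ^ 2 := by rw [card_product, sq]

section Bisector

variable {p : ℕ} [Fact p.Prime]

/-- Normalized coefficients of the perpendicular bisector of two points. -/
def bisector (q : Pt p × Pt p) : ZMod p × ZMod p × ZMod p :=
  if q.2.1 - q.1.1 ≠ 0 then (1, (q.2.2 - q.1.2) / (q.2.1 - q.1.1),
    (norm2 q.2 - norm2 q.1) / (q.2.1 - q.1.1))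
  else (0, 1, (norm2 q.2 - norm2 q.1) / (q.2.2 - q.1.2))

/-- The point `z` lies on the line with coefficients `k`. -/
def OnLine (z : Pt p) (k : ZMod p × ZMod p × ZMod p) : Prop :=
  2 * (k.1 * z.1 + k.2.1 * z.2) = k.2.2

instance (z : Pt p) (k : ZMod p × ZMod p × ZMod p) : Decidable (OnLine z k) :=
  inferInstanceAs (Decidable (_ = _))

theorem bisector_normalized (q : Pt p × Pt p) :
    (bisector q).1 = 1 ∨ (bisector q).1 = 0 ∧ (bisector q).2.1 = 1 := by
  rw [bisector]; split_ifs <;> simp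

theorem exists_bisector_smul {q : Pt p × Pt p} (hq : q.1 ≠ q.2) :
    ∃ l : ZMod p, l ≠ 0 ∧ q.2.1 - q.1.1 = l * (bisector q).1 ∧
      q.2.2 - q.1.2 = l * (bisector q).2.1 ∧ norm2 q.2 - norm2 q.1 = l * (bisector q).2.2 := by
  by_cases h : q.2.1 - q.1.1 = 0
  · have h' : q.2.2 - q.1.2 ≠ 0 := fun h' =>
      hq (Prod.ext (sub_eq_zero.1 h).symm (sub_eq_zero.1 h').symm)
    refine ⟨q.2.2 - q.1.2, h', ?_, ?_, ?_⟩ <;> simp only [bisector, h] <;> simp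
    field_simp
  · refine ⟨q.2.1 - q.1.1, h, ?_, ?_, ?_⟩ <;> simp only [bisector, h, ne_eq, not_false_eq_true,
      if_true] <;> field_simp

theorem onLine_bisector_iff {q : Pt p × Pt p} (hq : q.1 ≠ q.2) (z : Pt p) :
    OnLine z (bisector q) ↔ dist2 q.1 z = dist2 q.2 z := by
  obtain ⟨l, hl, h1, h2, h3⟩ := exists_bisector_smul hq
  simp only [OnLine, dist2, norm2] at *
  constructor
  · intro h
    linear_combination l * h + 2 * z.1 * h1 + 2 * z.2 * h2 - h3
  · intro h
    apply mul_left_cancel₀ hl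
    linear_combination h - 2 * z.1 * h1 - 2 * z.2 * h2 + h3

theorem bisector_eq_of_two_points (h2 : (2 : ZMod p) ≠ 0) {q q' : Pt p × Pt p} {z z' : Pt p}
    (hz : z ≠ z') (h₁ : OnLine z (bisector q)) (h₂ : OnLine z' (bisector q))
    (h₃ : OnLine z (bisector q')) (h₄ : OnLine z' (bisector q')) : bisector q = bisector q' := by
  have hn := bisector_normalized q
  have hn' := bisector_normalized q'
  generalize bisector q = k at *
  generalize bisector q' = k' at *
  obtain ⟨a, b, c⟩ := k
  obtain ⟨a', b', c'⟩ := k'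
  simp only [OnLine] at *
  have e : a * (z.1 - z'.1) + b * (z.2 - z'.2) = 0 := by
    apply mul_left_cancel₀ h2
    linear_combination h₁ - h₂
  have e' : a' * (z.1 - z'.1) + b' * (z.2 - z'.2) = 0 := by
    apply mul_left_cancel₀ h2
    linear_combination h₃ - h₄
  have hdet : a * b' - b * a' = 0 := by
    by_contra hne
    apply hz
    have f1 : (a * b' - b * a') * (z.1 - z'.1) = 0 := by linear_combination b' * e - b * e'
    have f2 : (a * b' - b * a') * (z.2 - z'.2) = 0 := by linear_combination a * e' - a' * e
    exact Prod.ext (sub_eq_zero.1 ((mul_eq_zero.1 f1).resolve_left hne))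
      (sub_eq_zero.1 ((mul_eq_zero.1 f2).resolve_left hne))
  have hab : a = a' ∧ b = b' := by
    rcases hn with rfl | ⟨rfl, rfl⟩ <;> rcases hn' with rfl | ⟨rfl, rfl⟩
    · exact ⟨rfl, by linear_combination -hdet⟩
    · simp at hdet
    · simp at hdet
    · exact ⟨rfl, rfl⟩
  obtain ⟨rfl, rfl⟩ := hab
  rw [← h₁, ← h₃]

theorem isMirror_of_bisector_eq {a b c d : Pt p} (hab : a ≠ b) (hcd : c ≠ d)
    (h : bisector (c, d) = bisector (a, b)) :
    dist2 a c = dist2 b d ∧ IsMirror a b c d := by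
  obtain ⟨l, hl, h1, h2, h3⟩ := exists_bisector_smul (q := (a, b)) hab
  obtain ⟨l', hl', h1', h2', h3'⟩ := exists_bisector_smul (q := (c, d)) hcd
  rw [h] at h1' h2' h3'
  generalize bisector (a, b) = k at *
  simp only [norm2] at *
  have e : (a.1 + b.1) * k.1 + (a.2 + b.2) * k.2.1 = k.2.2 := by
    apply mul_left_cancel₀ hl
    linear_combination h3 - (a.1 + b.1) * h1 - (a.2 + b.2) * h2
  have e' : (c.1 + d.1) * k.1 + (c.2 + d.2) * k.2.1 = k.2.2 := by
    apply mul_left_cancel₀ hl'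
    linear_combination h3' - (c.1 + d.1) * h1' - (c.2 + d.2) * h2'
  simp only [dist2, IsMirror]
  refine ⟨?_, ?_, ?_⟩
  · linear_combination (-((b.1 - d.1) + (a.1 - c.1))) * (h1 - h1') -
      ((b.2 - d.2) + (a.2 - c.2)) * (h2 - h2') - (l - l') * (e - e')
  · linear_combination ((b.1 - d.1) + (a.1 - c.1)) * h1 + ((b.2 - d.2) + (a.2 - c.2)) * h2 +
      l * (e - e')
  · linear_combination (b.1 - a.1) * (h2 - h2') - (b.2 - a.2) * (h1 - h1') +
      (l - l') * k.2.1 * h1 - (l - l') * k.1 * h2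

end Bisector

section Counting

variable {p : ℕ}

/-- The number of points of `E` at distance `t` from `z`. -/
def circleCard (E : Finset (Pt p)) (z : Pt p) (t : ZMod p) : ℕ :=
  (E.filter fun x => dist2 x z = t).card

/-- The number of triples in `E` whose first two points are equidistant from the third. -/
def equidistCount (E : Finset (Pt p)) : ℕ :=
  ∑ z ∈ E, ∑ t ∈ distSet E, circleCard E z t ^ 2

theorem card_pow_three_le (E : Finset (Pt p)) :
    E.card ^ 3 ≤ (distSet E).card * equidistCount E := by
  rw [equidistCount, mul_sum]
  calc E.card ^ 3 = ∑ _z ∈ E, E.card ^ 2 := by rw [sum_const, smul_eq_mul]; ring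
    _ ≤ _ := sum_le_sum fun z hz => by
      rw [card_eq_sum_card_fiberwise (f := fun x => dist2 x z) (t := distSet E)
        fun x hx => distSet_mem hx hz]
      exact sq_sum_le_card_mul_sum_sq

theorem card_pairsAt (E : Finset (Pt p)) (r : ZMod p) :
    (pairsAt E r).card = ∑ z ∈ E, circleCard E z r := by
  simp only [pairsAt, circleCard, card_filter]
  rw [sum_product_right]

theorem sum_card_pairsAt_sq_le (E : Finset (Pt p)) :
    ∑ r ∈ distSet E, (pairsAt E r).card ^ 2 ≤ E.card * equidistCount E := by
  rw [equidistCount, sum_comm, mul_sum]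
  refine sum_le_sum fun r _ => ?_
  rw [card_pairsAt]
  exact sq_sum_le_card_mul_sum_sq

theorem sum_card_pairsAt (E : Finset (Pt p)) :
    ∑ r ∈ distSet E, (pairsAt E r).card = E.card ^ 2 := by
  rw [sq, ← card_product]
  exact (card_eq_sum_card_fiberwise (f := fun q : Pt p × Pt p => dist2 q.1 q.2)
    fun q hq => distSet_mem (mem_product.1 hq).1 (mem_product.1 hq).2).symm

theorem equidistCount_le (E : Finset (Pt p)) :
    equidistCount E ≤ E.card ^ 2 + ∑ q ∈ E.offDiag,
      (E.filter fun z => dist2 q.1 z = dist2 q.2 z).card := by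
  have h1 : equidistCount E = ∑ q ∈ E ×ˢ E, (E.filter fun z => dist2 q.1 z = dist2 q.2 z).card := by
    simp only [card_filter]
    rw [sum_comm, equidistCount]
    refine sum_congr rfl fun z hz => ?_
    rw [← card_filter, card_eq_sum_card_fiberwise (f := fun q => dist2 q.1 z) (t := distSet E)
      fun q hq => distSet_mem (mem_product.1 (mem_filter.1 hq).1).1 hz]
    refine sum_congr rfl fun t _ => ?_
    rw [circleCard, sq, ← card_product]
    congr 1
    ext q
    simp only [mem_product, mem_filter]
    constructor
    · rintro ⟨⟨h1, h2⟩, h3, h4⟩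
      exact ⟨⟨⟨h1, h3⟩, h2.trans h4.symm⟩, h2⟩
    · rintro ⟨⟨⟨h1, h3⟩, h4⟩, h2⟩
      exact ⟨⟨h1, h2⟩, h3, h4.symm.trans h2⟩
  rw [h1, ← diag_union_offDiag, sum_union (disjoint_diag_offDiag E)]
  refine Nat.add_le_add_right ?_ _
  refine (sum_le_card_nsmul _ _ E.card fun q _ => card_filter_le _ _).trans ?_
  rw [diag_card, smul_eq_mul, sq]

variable [Fact p.Prime]

theorem sum_bisector_le (E : Finset (Pt p)) :
    ∑ q ∈ E.offDiag, (E.offDiag.filter fun q' => bisector q' = bisector q).card ≤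
      ∑ r ∈ distSet E, ∑ y ∈ pairsAt E r,
        ((pairsAt E r).filter fun x => IsMirror x.1 y.1 x.2 y.2).card := by
  have hcard : ∀ {α : Type} (A B : Finset α) (R : α → α → Prop) [∀ x y, Decidable (R x y)],
      ∑ x ∈ A, (B.filter fun y => R x y).card = ((A ×ˢ B).filter fun q => R q.1 q.2).card := by
    intro α A B R _
    simp only [card_filter]
    rw [sum_product]
  rw [hcard E.offDiag E.offDiag fun q q' => bisector q' = bisector q]
  rw [card_eq_sum_card_fiberwise (f := fun q => dist2 q.1.1 q.2.1) (t := distSet E)]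
  · refine sum_le_sum fun r _ => ?_
    rw [hcard (pairsAt E r) (pairsAt E r) fun y x => IsMirror x.1 y.1 x.2 y.2]
    refine card_le_card_of_injOn (fun q => ((q.1.2, q.2.2), (q.1.1, q.2.1))) ?_ ?_
    · rintro ⟨⟨a, b⟩, c, d⟩ hq
      simp only [coe_filter, mem_filter, mem_product, mem_offDiag, Set.mem_ofPred_eq, pairsAt]
        at hq ⊢
      obtain ⟨⟨⟨⟨ha, hb, hab⟩, hc, hd, hcd⟩, h⟩, hr⟩ := hq
      obtain ⟨h1, h2⟩ := isMirror_of_bisector_eq hab hcd h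
      exact ⟨⟨⟨⟨hb, hd⟩, h1 ▸ hr⟩, ⟨ha, hc⟩, hr⟩, h2⟩
    · rintro ⟨⟨a, b⟩, c, d⟩ _ ⟨⟨a', b'⟩, c', d'⟩ _ h
      simp only [Prod.mk.injEq] at h ⊢
      tauto
  · intro q hq
    rw [mem_coe, mem_filter, mem_product, mem_offDiag, mem_offDiag] at hq
    exact distSet_mem hq.1.1.1 hq.1.2.1

theorem exists_equidistCount_le (h2 : (2 : ZMod p) ≠ 0) (E : Finset (Pt p)) :
    ∃ U, equidistCount E ≤ 2 * E.card ^ 2 + U ∧ U ^ 2 ≤ (∑ r ∈ distSet E, ∑ y ∈ pairsAt E r,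
      ((pairsAt E r).filter fun x => IsMirror x.1 y.1 x.2 y.2).card) * E.card ^ 2 := by
  obtain ⟨U, hU, hU2⟩ := sum_incidences_le E.offDiag E bisector OnLine
    (fun l hl l' hl' z z' hz h₁ h₂ h₃ h₄ => by
      obtain ⟨q, -, rfl⟩ := mem_image.1 hl
      obtain ⟨q', -, rfl⟩ := mem_image.1 hl'
      exact bisector_eq_of_two_points h2 hz h₁ h₂ h₃ h₄)
  refine ⟨U, ?_, hU2.trans (Nat.mul_le_mul_right _ (sum_bisector_le E))⟩
  have h := equidistCount_le E
  rw [sum_congr rfl (g := fun q => (E.filter fun z => OnLine z (bisector q)).card)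
    fun q hq => by simp only [onLine_bisector_iff (mem_offDiag.1 hq).2.2]] at h
  have h3 : E.offDiag.card ≤ E.card ^ 2 := by
    rw [offDiag_card, sq]; exact Nat.sub_le _ _
  omega

end Counting

theorem anisotropic {p : ℕ} [Fact p.Prime] (h : p % 4 = 3) (x y : ZMod p)
    (hxy : x ^ 2 + y ^ 2 = 0) : x = 0 ∧ y = 0 := by
  have hy : y = 0 := by
    by_contra hy
    refine ZMod.mod_four_ne_three_of_sq_eq_neg_one (p := p) (y := x / y) ?_ h
    field_simp
    linear_combination hxy
  subst hy
  exact ⟨by simpa using hxy, rfl⟩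

theorem two_ne_zero_of_mod_four {p : ℕ} [Fact p.Prime] (h : p % 4 = 3) : (2 : ZMod p) ≠ 0 :=
  fun h2 => one_ne_zero (anisotropic h 1 1 (by linear_combination h2)).1

theorem sum_isMirror_le {p : ℕ} [Fact p.Prime] (h : p % 4 = 3) (E : Finset (Pt p)) (j : ℕ)
    (hp : 6 * 2 ^ j ≤ p) (hE : 4 ^ j * (distSet E).card ≤ E.card ^ 2) (hne : E.Nonempty) :
    ((∑ r ∈ distSet E, ∑ y ∈ pairsAt E r,
      ((pairsAt E r).filter fun x => IsMirror x.1 y.1 x.2 y.2).card : ℕ) : ℝ) ≤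
    24 * E.card * equidistCount E / 2 ^ j +
      2 * (distSet E).card * E.card * equidistCount E / (2 ^ j) ^ 2 +
      E.card ^ 2 * (69144 * 2 ^ j + 5760 * (distSet E).card * (j + 1)) := by
  set D := (distSet E).card with hD
  set N := E.card with hN
  obtain ⟨x, hx⟩ := hne
  have hD1 : 1 ≤ D := card_pos.2 ⟨_, distSet_mem hx hx⟩
  have hD1' : (1 : ℝ) ≤ D := by exact_mod_cast hD1
  set s : ℝ := 2 ^ j with hs
  have hs1 : 1 ≤ s := one_le_pow₀ (by norm_num)
  have h4 : (4 : ℝ) ^ j = s ^ 2 := by rw [hs, ← pow_mul, mul_comm, pow_mul]; norm_num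
  have h8 : (8 : ℝ) ^ j = s ^ 3 := by rw [hs, ← pow_mul, mul_comm, pow_mul]; norm_num
  have hE' : s ^ 2 * D ≤ (N : ℝ) ^ 2 := by rw [← h4]; exact_mod_cast hE
  have hterm : ∀ r ∈ distSet E, ((∑ y ∈ pairsAt E r,
      ((pairsAt E r).filter fun x => IsMirror x.1 y.1 x.2 y.2).card : ℕ) : ℝ) ≤
      (if r = 0 then (N : ℝ) ^ 2 else 0) + (24 / s + 2 * D / s ^ 2) * (pairsAt E r).card ^ 2 +
      (34584 * s + 2 * D + 2880 * D * j) * (pairsAt E r).card +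
      (34560 * s ^ 3 + 2880 * D * j * s ^ 2) := by
    intro r _
    set n := (pairsAt E r).card with hn
    by_cases hr : r = 0
    · rw [if_pos hr]
      have hn0 : n ≤ N := by
        refine card_le_card_of_injOn Prod.fst (fun q hq => ?_) fun q hq q' hq' hqq => ?_
        · exact (mem_product.1 (mem_filter.1 (mem_coe.1 hq)).1).1
        · have key : ∀ q ∈ pairsAt E r, q.2 = q.1 := fun q hq => by
            have h1 := (mem_filter.1 hq).2
            rw [hr, dist2] at h1
            have := anisotropic h _ _ h1
            exact Prod.ext (sub_eq_zero.1 this.1).symm (sub_eq_zero.1 this.2).symm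
          refine Prod.ext hqq ?_
          rw [key q (mem_coe.1 hq), key q' (mem_coe.1 hq'), hqq]
      have h1 : ∑ y ∈ pairsAt E r, ((pairsAt E r).filter fun x => IsMirror x.1 y.1 x.2 y.2).card ≤
          N ^ 2 := by
        refine (sum_le_card_nsmul _ _ n fun y _ => card_filter_le _ _).trans ?_
        rw [smul_eq_mul, sq]
        exact Nat.mul_le_mul hn0 hn0
      have h2 : ((∑ y ∈ pairsAt E r,
        ((pairsAt E r).filter fun x => IsMirror x.1 y.1 x.2 y.2).card : ℕ) : ℝ) ≤ (N : ℝ) ^ 2 := by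
        exact_mod_cast h1
      have : (0 : ℝ) ≤ (24 / s + 2 * D / s ^ 2) * (n : ℝ) ^ 2 +
        (34584 * s + 2 * D + 2880 * D * j) * n + (34560 * s ^ 3 + 2880 * D * j * s ^ 2) := by
        positivity
      linarith
    · rw [if_neg hr]
      have h1 := card_isMirror_le (anisotropic h) E hr j hp
      rw [← hn, ← hD] at h1
      have h2 : ((n / 4 ^ j : ℕ) : ℝ) ≤ n / s ^ 2 := by
        rw [← h4]
        exact_mod_cast Nat.cast_div_le (α := ℝ) (m := n) (n := 4 ^ j)
      have h3 : ((∑ y ∈ pairsAt E r,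
        ((pairsAt E r).filter fun x => IsMirror x.1 y.1 x.2 y.2).card : ℕ) : ℝ) ≤
        (((n / 4 ^ j : ℕ) : ℝ) + 1) * (n * (24 * s + 2 * D) +
          (34560 * s ^ 3 + 1440 * (2 * D) * j * s ^ 2)) := by
        rw [← h8, ← h4, hs]
        exact_mod_cast h1
      refine h3.trans ?_
      calc _ ≤ ((n : ℝ) / s ^ 2 + 1) * (n * (24 * s + 2 * D) +
          (34560 * s ^ 3 + 1440 * (2 * D) * j * s ^ 2)) := by gcongr
        _ = _ := by field_simp; ring
  have hsum := sum_le_sum hterm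
  rw [Nat.cast_sum]
  refine hsum.trans ?_
  simp only [sum_add_distrib, ← mul_sum, sum_const, nsmul_eq_mul]
  have e1 : ∑ r ∈ distSet E, ((pairsAt E r).card : ℝ) = (N : ℝ) ^ 2 := by
    exact_mod_cast sum_card_pairsAt E
  have e2 : ∑ r ∈ distSet E, ((pairsAt E r).card : ℝ) ^ 2 ≤ N * equidistCount E := by
    exact_mod_cast sum_card_pairsAt_sq_le E
  have e3 : ∑ r ∈ distSet E, (if r = 0 then (N : ℝ) ^ 2 else 0) ≤ (N : ℝ) ^ 2 := by
    rw [sum_ite_eq']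
    split_ifs
    · exact le_rfl
    · positivity
  rw [e1, ← hD]
  have e4 : (24 / s + 2 * D / s ^ 2) * ∑ r ∈ distSet E, ((pairsAt E r).card : ℝ) ^ 2 ≤
      (24 / s + 2 * D / s ^ 2) * (N * equidistCount E) := by gcongr
  have e5 : (D : ℝ) * (34560 * s ^ 3 + 2880 * D * j * s ^ 2) ≤
      (34560 * s + 2880 * D * j) * (N : ℝ) ^ 2 := by
    calc _ = (34560 * s + 2880 * D * j) * (s ^ 2 * D) := by ring
      _ ≤ _ := by gcongr
  have e6 : (24 / s + 2 * D / s ^ 2) * (N * equidistCount E) =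
      24 * N * equidistCount E / s + 2 * D * N * equidistCount E / s ^ 2 := by ring
  have e7 : (N : ℝ) ^ 2 ≤ D * (N : ℝ) ^ 2 := le_mul_of_one_le_left (by positivity) hD1'
  have e8 : 0 ≤ (D : ℝ) * (N : ℝ) ^ 2 := by positivity
  linarith

/-- The dichotomy at a single dyadic scale. -/
theorem scale_dichotomy {p : ℕ} [Fact p.Prime] (h : p % 4 = 3) (E : Finset (Pt p)) (j : ℕ)
    (hp : 6 * 2 ^ j ≤ p) (hE : 4 ^ j * (distSet E).card ≤ E.card ^ 2) (hne : E.Nonempty) :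
    (2 : ℝ) ^ j ≤ 288 * (distSet E).card ∨
      (E.card : ℝ) ^ 2 ≤ 10 ^ 13 * (distSet E).card ^ 3 * (j + 1) := by
  have hB := sum_isMirror_le h E j hp hE hne
  obtain ⟨U, hU, hU2⟩ := exists_equidistCount_le (two_ne_zero_of_mod_four h) E
  have hDT := card_pow_three_le E
  obtain ⟨x, hx⟩ := hne
  have hD1 : (1 : ℝ) ≤ (distSet E).card := by
    exact_mod_cast card_pos.2 ⟨_, distSet_mem hx hx⟩
  have hN1 : (1 : ℝ) ≤ E.card := by exact_mod_cast card_pos.2 ⟨x, hx⟩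
  have hs1 : (1 : ℝ) ≤ 2 ^ j := one_le_pow₀ (by norm_num)
  have hE' : ((2 : ℝ) ^ j) ^ 2 * (distSet E).card ≤ (E.card : ℝ) ^ 2 := by
    rw [← pow_mul, mul_comm j, pow_mul]
    exact_mod_cast hE
  generalize (∑ r ∈ distSet E, ∑ y ∈ pairsAt E r,
      ((pairsAt E r).filter fun x => IsMirror x.1 y.1 x.2 y.2).card) = B at *
  have hU' : (equidistCount E : ℝ) ≤ 2 * (E.card : ℝ) ^ 2 + U := by exact_mod_cast hU
  have hU2' : (U : ℝ) ^ 2 ≤ B * (E.card : ℝ) ^ 2 := by exact_mod_cast hU2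
  have hDT' : (E.card : ℝ) ^ 3 ≤ (distSet E).card * (equidistCount E : ℝ) := by exact_mod_cast hDT
  have hT0 : (0 : ℝ) ≤ equidistCount E := Nat.cast_nonneg _
  have hJ0 : (0 : ℝ) ≤ j := Nat.cast_nonneg _
  have hU0 : (0 : ℝ) ≤ U := Nat.cast_nonneg _
  generalize (equidistCount E : ℝ) = T at *
  generalize (U : ℝ) = U at *
  generalize (B : ℝ) = B at *
  generalize ((distSet E).card : ℝ) = D at *
  generalize (E.card : ℝ) = N at *
  generalize (2 : ℝ) ^ j = s at *
  generalize (j : ℝ) = J at *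
  clear hU hU2 hDT hE h hp hx
  have hT : 0 < T := by
    by_contra hcon
    have : T = 0 := le_antisymm (not_lt.1 hcon) hT0
    rw [this, mul_zero] at hDT'
    have : 1 ≤ N ^ 3 := one_le_pow₀ hN1
    linarith
  by_cases hT4 : T ≤ 4 * N ^ 2
  · right
    have h1 : N ≤ 4 * D := by
      have : N * N ^ 2 ≤ 4 * D * N ^ 2 := by nlinarith
      exact le_of_mul_le_mul_right this (by positivity)
    calc N ^ 2 ≤ (4 * D) ^ 2 := by gcongr
      _ = 16 * D ^ 2 * 1 * 1 := by ring
      _ ≤ 10 ^ 13 * D ^ 2 * D * (J + 1) := by gcongr <;> linarith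
      _ = _ := by ring
  have hTU : T ≤ 2 * U := by linarith
  have hT2 : T ^ 2 ≤ 4 * (N ^ 2 * B) := by nlinarith
  have hT3 : T ^ 2 ≤ 96 * N ^ 3 * T / s + 8 * D * N ^ 3 * T / s ^ 2 +
      4 * N ^ 4 * (69144 * s + 5760 * D * (J + 1)) := by
    refine hT2.trans ?_
    calc 4 * (N ^ 2 * B) ≤ 4 * (N ^ 2 * (24 * N * T / s + 2 * D * N * T / s ^ 2 +
          N ^ 2 * (69144 * s + 5760 * D * (J + 1)))) := by gcongr
      _ = _ := by ring
  by_contra! hcon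
  obtain ⟨c1, c2⟩ := hcon
  have hND : N ^ 3 / D ≤ T := by rw [div_le_iff₀ (by positivity)]; linarith
  have k1 : 96 * N ^ 3 * T / s ≤ T ^ 2 / 3 := by
    rw [div_le_iff₀ (by positivity)]
    have : N ^ 3 * 288 ≤ T * s := by
      calc N ^ 3 * 288 ≤ D * T * 288 := by gcongr
        _ = T * (288 * D) := by ring
        _ ≤ _ := by gcongr
    nlinarith
  have k2 : 8 * D * N ^ 3 * T / s ^ 2 ≤ T ^ 2 / 3 := by
    rw [div_le_iff₀ (by positivity)]
    have : D * N ^ 3 * 24 ≤ T * s ^ 2 := by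
      calc D * N ^ 3 * 24 ≤ D * (D * T) * 24 := by gcongr
        _ ≤ D * (D * T) * 288 ^ 2 := by gcongr; norm_num
        _ = T * (288 * D) ^ 2 := by ring
        _ ≤ _ := by gcongr
    nlinarith
  have k3 : T ^ 2 ≤ 12 * N ^ 4 * (69144 * s + 5760 * D * (J + 1)) := by linarith
  have k4 : N ^ 2 ≤ 12 * D ^ 2 * (69144 * s + 5760 * D * (J + 1)) := by
    have : N ^ 2 * N ^ 4 ≤ 12 * D ^ 2 * (69144 * s + 5760 * D * (J + 1)) * N ^ 4 := by
      calc N ^ 2 * N ^ 4 = (N ^ 3) ^ 2 := by ring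
        _ ≤ (D * T) ^ 2 := by gcongr
        _ = D ^ 2 * T ^ 2 := by ring
        _ ≤ D ^ 2 * (12 * N ^ 4 * (69144 * s + 5760 * D * (J + 1))) := by gcongr
        _ = _ := by ring
    exact le_of_mul_le_mul_right this (by positivity)
  have hX : D ^ 3 ≤ D ^ 3 * (J + 1) := le_mul_of_one_le_right (by positivity) (by linarith)
  have k5 : N ^ 2 ≤ 1659456 * D ^ 2 * s := by nlinarith
  have k6 : N ^ 2 * N ^ 2 ≤ 1659456 ^ 2 * D ^ 3 * N ^ 2 := by
    calc N ^ 2 * N ^ 2 ≤ (1659456 * D ^ 2 * s) * (1659456 * D ^ 2 * s) := by gcongr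
      _ = 1659456 ^ 2 * D ^ 3 * (s ^ 2 * D) := by ring
      _ ≤ _ := by gcongr
  have k7 : N ^ 2 ≤ 1659456 ^ 2 * D ^ 3 := le_of_mul_le_mul_right k6 (by positivity)
  have : (0 : ℝ) < D ^ 3 := by positivity
  nlinarith

theorem exists_scale {p : ℕ} [Fact p.Prime] (h : p % 4 = 3) (E : Finset (Pt p))
    (hne : E.Nonempty) :
    (p : ℝ) ≤ 3456 * (distSet E).card ∨ ∃ j : ℕ, 2 ^ j ≤ E.card ∧
      (E.card : ℝ) ^ 2 ≤ 10 ^ 13 * (distSet E).card ^ 3 * (j + 1) := by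
  obtain ⟨x, hx⟩ := id hne
  have hD1 : 1 ≤ (distSet E).card := card_pos.2 ⟨_, distSet_mem hx hx⟩
  have hN1 : 1 ≤ E.card := card_pos.2 ⟨x, hx⟩
  have hD1' : (1 : ℝ) ≤ (distSet E).card := by exact_mod_cast hD1
  by_cases hp6 : p < 6
  · left
    have : (p : ℝ) ≤ 6 := by exact_mod_cast hp6.le
    linarith
  have hDN : (distSet E).card ≤ E.card ^ 2 := by
    rw [sq, ← card_product]; exact card_image_le
  set P : ℕ → Prop := fun j => 6 * 2 ^ j ≤ p ∧ 4 ^ j * (distSet E).card ≤ E.card ^ 2 with hP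
  have hPb : ∀ j, P j → 2 ^ j ≤ E.card := fun j hj => by
    have h1 : (2 ^ j) ^ 2 ≤ E.card ^ 2 := by
      rw [← pow_mul, mul_comm, pow_mul]
      exact (Nat.le_mul_of_pos_right _ hD1).trans hj.2
    exact (Nat.pow_le_pow_iff_left two_ne_zero).1 h1
  classical
  have hP0 : P 0 := ⟨by omega, by simpa using hDN⟩
  have hfin : ∀ j, P j → j ≤ E.card := fun j hj => (Nat.lt_two_pow_self).le.trans (hPb j hj)
  set j := Nat.findGreatest P E.card with hj
  have hPj : P j := Nat.findGreatest_spec (Nat.zero_le _) hP0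
  have hPj' : ¬ P (j + 1) := fun hcon => by
    have := Nat.le_findGreatest (hfin _ hcon) hcon
    omega
  rcases scale_dichotomy h E j hPj.1 hPj.2 hne with h1 | h1
  · by_cases hc : 6 * 2 ^ (j + 1) ≤ p
    · right
      refine ⟨j, hPb j hPj, ?_⟩
      have h2 : E.card ^ 2 < 4 ^ (j + 1) * (distSet E).card := by
        by_contra! hcon
        exact hPj' ⟨hc, hcon⟩
      have h3 : (E.card : ℝ) ^ 2 ≤ 4 ^ (j + 1) * (distSet E).card := by exact_mod_cast h2.le
      have h4 : (4 : ℝ) ^ (j + 1) = 4 * (2 ^ j) ^ 2 := by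
        rw [pow_succ, ← pow_mul, mul_comm j, pow_mul]; norm_num; ring
      rw [h4] at h3
      calc (E.card : ℝ) ^ 2 ≤ 4 * (2 ^ j) ^ 2 * (distSet E).card := h3
        _ ≤ 4 * (288 * (distSet E).card) ^ 2 * (distSet E).card := by gcongr
        _ = 331776 * (distSet E).card ^ 3 * 1 := by ring
        _ ≤ _ := by gcongr <;> norm_num
    · left
      have h2 : p ≤ 12 * 2 ^ j := by rw [pow_succ] at hc; omega
      have h3 : (p : ℝ) ≤ 12 * 2 ^ j := by exact_mod_cast h2
      linarith
  · exact Or.inr ⟨j, hPb j hPj, h1⟩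

theorem card_sq_le_offDiag {α κ : Type*} [DecidableEq α] [DecidableEq κ] [Fintype κ]
    (A : Finset α) (f : α → κ) :
    A.card ^ 2 ≤ Fintype.card κ * ((A.offDiag.filter fun q => f q.1 = f q.2).card + A.card) := by
  have h1 : ((A ×ˢ A).filter fun q => f q.1 = f q.2).card =
      ∑ k : κ, (A.filter fun x => f x = k).card ^ 2 := by
    rw [card_eq_sum_card_fiberwise (f := fun q => f q.1) (t := univ) fun _ _ => mem_univ _]
    refine sum_congr rfl fun k _ => ?_
    rw [sq, ← card_product]
    congr 1
    ext q
    simp only [mem_product, mem_filter]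
    constructor
    · rintro ⟨⟨⟨h1, h2⟩, h3⟩, h4⟩
      exact ⟨⟨h1, h4⟩, h2, h3.symm.trans h4⟩
    · rintro ⟨⟨h1, h4⟩, h2, h3⟩
      exact ⟨⟨⟨h1, h2⟩, h4.trans h3.symm⟩, h4⟩
  have h2 : ((A ×ˢ A).filter fun q => f q.1 = f q.2).card ≤
      (A.offDiag.filter fun q => f q.1 = f q.2).card + A.card := by
    rw [← diag_union_offDiag, filter_union, add_comm]
    refine (card_union_le _ _).trans (Nat.add_le_add_right ((card_filter_le _ _).trans ?_) _)
    rw [diag_card]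
  refine le_trans ?_ (Nat.mul_le_mul_left _ h2)
  rw [h1, card_eq_sum_card_fiberwise (f := f) (t := univ) (s := A) fun _ _ => mem_univ _]
  exact sq_sum_le_card_mul_sum_sq

section Rectangles

variable {p : ℕ} [Fact p.Prime]

/-- The horizontal pairs of `E` in the orthogonal frame `(1, t)`, `(-t, 1)`. -/
def frameSides (E : Finset (Pt p)) (t : ZMod p) : Finset (Pt p × Pt p) :=
  E.offDiag.filter fun q => q.1.2 - t * q.1.1 = q.2.2 - t * q.2.1

/-- Pairs of opposite horizontal sides of the rectangles of `E` in the frame `(1, t)`, `(-t, 1)`. -/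
def frameRects (E : Finset (Pt p)) (t : ZMod p) : Finset ((Pt p × Pt p) × (Pt p × Pt p)) :=
  (frameSides E t).offDiag.filter fun q =>
    (q.1.1.1 + t * q.1.1.2, q.1.2.1 + t * q.1.2.2) = (q.2.1.1 + t * q.2.1.2, q.2.2.1 + t * q.2.2.2)

theorem card_frameRects_ge (E : Finset (Pt p)) (t : ZMod p) (hE : 4 * p ^ 3 ≤ E.card ^ 2) :
    (E.card : ℝ) ^ 4 ≤ 8 * (p : ℝ) ^ 4 * (frameRects E t).card := by
  have h1 := card_sq_le_offDiag E fun z => z.2 - t * z.1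
  have h2 := card_sq_le_offDiag (frameSides E t) fun q =>
    (q.1.1 + t * q.1.2, q.2.1 + t * q.2.2)
  rw [ZMod.card] at h1
  rw [Fintype.card_prod, ZMod.card] at h2
  change _ ≤ p * ((frameSides E t).card + _) at h1
  change _ ≤ p * p * ((frameRects E t).card + _) at h2
  have h1' : (E.card : ℝ) ^ 2 ≤ p * ((frameSides E t).card + E.card) := by exact_mod_cast h1
  have h2' : ((frameSides E t).card : ℝ) ^ 2 ≤
      p * p * ((frameRects E t).card + (frameSides E t).card) := by exact_mod_cast h2
  have hE' : 4 * (p : ℝ) ^ 3 ≤ (E.card : ℝ) ^ 2 := by exact_mod_cast hE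
  have hp : (1 : ℝ) ≤ p := by exact_mod_cast (Fact.out : p.Prime).one_le
  have hN0 : (0 : ℝ) ≤ E.card := Nat.cast_nonneg _
  have hQ0 : (0 : ℝ) ≤ (frameRects E t).card := Nat.cast_nonneg _
  generalize ((frameRects E t).card : ℝ) = Q at *
  generalize ((frameSides E t).card : ℝ) = A at *
  generalize (E.card : ℝ) = N at *
  generalize (p : ℝ) = P at *
  clear h1 h2 hE
  have hNP : 2 * P ≤ N := by
    refine le_of_sq_le_sq ?_ hN0
    nlinarith [mul_le_mul_of_nonneg_right hp (sq_nonneg P)]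
  have hA : N ^ 2 ≤ 2 * P * A := by nlinarith
  have hA2 : 2 * P ^ 2 ≤ A := by
    have : 2 * P ^ 2 * (2 * P) ≤ A * (2 * P) := by nlinarith
    exact le_of_mul_le_mul_right this (by positivity)
  have hA3 : A ^ 2 ≤ 2 * P ^ 2 * Q := by nlinarith
  calc N ^ 4 = (N ^ 2) ^ 2 := by ring
    _ ≤ (2 * P * A) ^ 2 := by gcongr
    _ = 4 * P ^ 2 * A ^ 2 := by ring
    _ ≤ 4 * P ^ 2 * (2 * P ^ 2 * Q) := by gcongr
    _ = _ := by ring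

theorem not_collinear_of_isCorner (hF : ∀ x y : ZMod p, x ^ 2 + y ^ 2 = 0 → x = 0 ∧ y = 0)
    {a b c d : Pt p} (hab : a ≠ b) (had : a ≠ d) (h : IsCorner a b d) :
    ¬ Collinear (ZMod p) ({a, b, c, d} : Set (Pt p)) := by
  intro hc
  obtain ⟨v, hv⟩ := (collinear_iff_of_mem (k := ZMod p) (p₀ := a) (by simp)).1 hc
  obtain ⟨s, hs⟩ := hv b (by simp)
  obtain ⟨u, hu⟩ := hv d (by simp)
  subst hs hu
  simp only [IsCorner, vadd_eq_add, Prod.fst_add, Prod.snd_add, Prod.smul_fst, Prod.smul_snd,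
    smul_eq_mul] at h
  have h' : s * u * (v.1 ^ 2 + v.2 ^ 2) = 0 := by linear_combination h
  rcases mul_eq_zero.1 h' with h' | h'
  · rcases mul_eq_zero.1 h' with rfl | rfl
    · simp at hab
    · simp at had
  · have hv0 : v = 0 := Prod.ext (hF _ _ h').1 (hF _ _ h').2
    subst hv0
    simp at hab

theorem eq_of_frame_eq (hF : ∀ x y : ZMod p, x ^ 2 + y ^ 2 = 0 → x = 0 ∧ y = 0) {t : ZMod p}
    {z w : Pt p} (h₁ : z.1 + t * z.2 = w.1 + t * w.2) (h₂ : z.2 - t * z.1 = w.2 - t * w.1) :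
    z = w := by
  have := eq_zero_of_complex_mul_eq_zero hF (g₁ := 1) (g₂ := -t) (Or.inl one_ne_zero)
    (x := z.1 - w.1) (y := z.2 - w.2) (by linear_combination h₁) (by linear_combination h₂)
  exact Prod.ext (sub_eq_zero.1 this.1) (sub_eq_zero.1 this.2)

theorem sum_card_frameRects_le (hF : ∀ x y : ZMod p, x ^ 2 + y ^ 2 = 0 → x = 0 ∧ y = 0)
    (E : Finset (Pt p)) : ∑ t, (frameRects E t).card ≤ rectCount p E := by
  classical
  have hmem : ∀ {t : ZMod p} {a b c d : Pt p}, ((a, d), (b, c)) ∈ frameRects E t →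
      (a ∈ E ∧ b ∈ E ∧ c ∈ E ∧ d ∈ E) ∧ a ≠ d ∧ a ≠ b ∧ a.2 - t * a.1 = d.2 - t * d.1 ∧
      b.2 - t * b.1 = c.2 - t * c.1 ∧ a.1 + t * a.2 = b.1 + t * b.2 ∧
      d.1 + t * d.2 = c.1 + t * c.2 := by
    intro t a b c d h
    simp only [frameRects, frameSides, mem_filter, mem_offDiag, Prod.mk.injEq, ne_eq] at h
    obtain ⟨⟨⟨⟨ha, hd, had⟩, h1⟩, ⟨⟨hb, hc, hbc⟩, h2⟩, hne⟩, h3, h4⟩ := h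
    refine ⟨⟨ha, hb, hc, hd⟩, had, ?_, h1, h2, h3, h4⟩
    rintro rfl
    exact hne ⟨rfl, eq_of_frame_eq hF h4 (h1.symm.trans h2)⟩
  rw [← card_sigma, rectCount]
  rw [← card_image_of_injOn (s := univ.sigma fun t => frameRects E t)
    (f := fun q => (q.2.1.1, q.2.2.1, q.2.2.2, q.2.1.2)), ← Set.ncard_coe_finset]
  · refine Set.ncard_le_ncard ?_ (Set.toFinite _)
    intro q hq
    simp only [coe_image, Set.mem_image, mem_coe, mem_sigma, mem_univ, true_and] at hq
    obtain ⟨⟨t, ⟨a, d⟩, b, c⟩, h, rfl⟩ := hq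
    obtain ⟨⟨ha, hb, hc, hd⟩, had, hab, h1, h2, h3, h4⟩ := hmem h
    have hcor : IsCorner a b d := by
      simp only [IsCorner]
      linear_combination (-(d.1 - a.1)) * h3 - (b.2 - a.2) * h1
    refine ⟨ha, hb, hc, hd, ⟨hcor, ?_, ?_, ?_⟩, not_collinear_of_isCorner hF hab had hcor⟩
    · simp only [IsCorner]
      linear_combination (c.1 - b.1) * h3 - (a.2 - b.2) * h2
    · simp only [IsCorner]
      linear_combination (b.1 - c.1) * h4 + (d.2 - c.2) * h2
    · simp only [IsCorner]
      linear_combination (-(a.1 - d.1)) * h4 + (c.2 - d.2) * h1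
  · rintro ⟨t, ⟨a, d⟩, b, c⟩ h ⟨t', ⟨a', d'⟩, b', c'⟩ h' heq
    simp only [coe_sigma, Set.mem_sigma_iff, mem_coe, mem_univ, true_and] at h h'
    simp only [Prod.mk.injEq] at heq
    obtain ⟨rfl, rfl, rfl, rfl⟩ := heq
    obtain ⟨-, -, hab, -, -, h3, -⟩ := hmem (by simpa using h)
    obtain ⟨-, -, -, -, -, h3', -⟩ := hmem (by simpa using h')
    have : t = t' := by
      have h5 : (t - t') * (a.2 - b.2) = 0 := by linear_combination h3 - h3'
      rcases mul_eq_zero.1 h5 with h6 | h6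
      · exact sub_eq_zero.1 h6
      · exact absurd (Prod.ext (by linear_combination h3 - t * h6) (sub_eq_zero.1 h6)) hab
    subst this
    rfl

theorem rectCount_ge (h : p % 4 = 3) (E : Finset (Pt p)) (hE : 4 * p ^ 3 ≤ E.card ^ 2) :
    (E.card : ℝ) ^ 4 ≤ 8 * (p : ℝ) ^ 3 * rectCount p E := by
  have h1 : ((∑ t, (frameRects E t).card : ℕ) : ℝ) ≤ rectCount p E := by
    exact_mod_cast sum_card_frameRects_le (anisotropic h) E
  have h2 := sum_le_sum fun t (_ : t ∈ (univ : Finset (ZMod p))) => card_frameRects_ge E t hE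
  rw [sum_const, card_univ, ZMod.card, nsmul_eq_mul, ← mul_sum, ← Nat.cast_sum] at h2
  have hp : (0 : ℝ) < p := by exact_mod_cast (Fact.out : p.Prime).pos
  have h3 : (p : ℝ) * E.card ^ 4 ≤ p * (8 * (p : ℝ) ^ 3 * rectCount p E) := by
    refine h2.trans ?_
    calc _ ≤ 8 * (p : ℝ) ^ 4 * rectCount p E := by gcongr
      _ = _ := by ring
  exact le_of_mul_le_mul_left h3 hp

end Rectangles

theorem add_one_le_mul_rpow {n : ℝ} {j : ℕ} (hj : (2 : ℝ) ^ j ≤ n) :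
    (j : ℝ) + 1 ≤ 19 * n ^ ((2 : ℝ) / 19) := by
  have h2 : (1 : ℝ) + 1 / 19 ≤ (2 : ℝ) ^ ((2 : ℝ) / 19) := by
    rw [Real.rpow_def_of_pos two_pos]
    have h1 := Real.add_one_le_exp (Real.log 2 * (2 / 19))
    have h3 := Real.log_two_gt_d9
    linarith
  have h3 : 1 + (j : ℝ) * (1 / 19) ≤ ((2 : ℝ) ^ ((2 : ℝ) / 19)) ^ j :=
    (one_add_mul_le_pow (by norm_num) j).trans (pow_le_pow_left₀ (by norm_num) h2 j)
  have h4 : ((2 : ℝ) ^ ((2 : ℝ) / 19)) ^ j ≤ n ^ ((2 : ℝ) / 19) := by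
    rw [← Real.rpow_natCast, ← Real.rpow_mul two_pos.le, mul_comm, Real.rpow_mul two_pos.le,
      Real.rpow_natCast]
    exact Real.rpow_le_rpow (by positivity) hj (by norm_num)
  linarith

theorem rpow_le_of_sq_le {n d : ℝ} {j : ℕ} (hd : 0 ≤ d) (hj : (2 : ℝ) ^ j ≤ n)
    (h : n ^ 2 ≤ 10 ^ 13 * d ^ 3 * (j + 1)) : n ^ ((12 : ℝ) / 19) ≤ 10 ^ 5 * d := by
  have hn : 0 < n := lt_of_lt_of_le (by positivity) hj
  have hs : 0 < n ^ ((2 : ℝ) / 19) := by positivity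
  have h1 : (n ^ ((12 : ℝ) / 19)) ^ 3 * n ^ ((2 : ℝ) / 19) = n ^ 2 := by
    rw [← Real.rpow_natCast, ← Real.rpow_mul hn.le, ← Real.rpow_add hn, ← Real.rpow_natCast]
    norm_num
  have h2 : n ^ 2 ≤ 10 ^ 13 * d ^ 3 * (19 * n ^ ((2 : ℝ) / 19)) :=
    h.trans (by gcongr; exact add_one_le_mul_rpow hj)
  have h3 : (n ^ ((12 : ℝ) / 19)) ^ 3 ≤ 10 ^ 13 * d ^ 3 * 19 := by
    refine le_of_mul_le_mul_right ?_ hs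
    rw [h1]
    linarith
  refine le_of_pow_le_pow_left₀ three_ne_zero (by positivity) (h3.trans ?_)
  have : 0 ≤ d ^ 3 := by positivity
  nlinarith

theorem rpow_le_of_sq_lt {n q : ℝ} (hn : 0 ≤ n) (hq : 1 ≤ q) (h : n ^ 2 < 4 * q ^ 3) :
    n ^ ((12 : ℝ) / 19) ≤ 2 * q := by
  have h1 : n ^ ((12 : ℝ) / 19) = (n ^ 2) ^ ((6 : ℝ) / 19) := by
    rw [← Real.rpow_natCast, ← Real.rpow_mul hn]
    norm_num
  have h2 : n ^ 2 ≤ (2 * q) ^ 3 := by nlinarith [pow_pos (one_pos.trans_le hq) 3]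
  calc n ^ ((12 : ℝ) / 19) = (n ^ 2) ^ ((6 : ℝ) / 19) := h1
    _ ≤ ((2 * q) ^ 3) ^ ((6 : ℝ) / 19) := Real.rpow_le_rpow (by positivity) h2 (by norm_num)
    _ = (2 * q) ^ ((18 : ℝ) / 19) := by
      rw [← Real.rpow_natCast, ← Real.rpow_mul (by positivity)]
      norm_num
    _ ≤ (2 * q) ^ (1 : ℝ) := Real.rpow_le_rpow_of_exponent_le (by linarith) (by norm_num)
    _ = 2 * q := Real.rpow_one _

theorem pow_le_mul_of_scale_le {n d q s : ℝ} (hn : 0 ≤ n) (hd : 0 ≤ d) (hq : 1 ≤ q)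
    (hnq : n ≤ q ^ ((8 : ℝ) / 5)) (h₁ : q ≤ 3456 * d) (h₂ : n ^ 4 ≤ 8 * q ^ 3 * s) :
    n ^ 20 ≤ 10 ^ 80 * (d ^ 19 * s ^ 4) := by
  have hq0 : 0 < q := one_pos.trans_le hq
  have h4 : n ^ 4 ≤ q ^ 7 := by
    calc n ^ 4 ≤ (q ^ ((8 : ℝ) / 5)) ^ 4 := pow_le_pow_left₀ hn hnq 4
      _ = q ^ ((32 : ℝ) / 5) := by
        rw [← Real.rpow_natCast, ← Real.rpow_mul hq0.le]
        norm_num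
      _ ≤ q ^ (7 : ℝ) := Real.rpow_le_rpow_of_exponent_le hq (by norm_num)
      _ = q ^ 7 := by norm_cast
  have h5 : q ^ 12 * (n ^ 4) ≤ (3456 * d) ^ 19 := by
    calc q ^ 12 * n ^ 4 ≤ q ^ 12 * q ^ 7 := by gcongr
      _ = q ^ 19 := by ring
      _ ≤ _ := pow_le_pow_left₀ hq0.le h₁ 19
  calc n ^ 20 = (n ^ 4) ^ 4 * n ^ 4 := by ring
    _ ≤ (8 * q ^ 3 * s) ^ 4 * n ^ 4 := by gcongr
    _ = 8 ^ 4 * s ^ 4 * (q ^ 12 * n ^ 4) := by ring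
    _ ≤ 8 ^ 4 * s ^ 4 * (3456 * d) ^ 19 := by gcongr
    _ = (8 ^ 4 * 3456 ^ 19) * (d ^ 19 * s ^ 4) := by ring
    _ ≤ _ := by gcongr; norm_num

/-- There exist absolute constants `C, c > 0` such that for every prime `p ≡ 3 (mod 4)` and
every `E ⊆ 𝔽_p²` with `|E| ≤ c·p^{8/5}`, either `|Δ(E)| ≥ C·|E|^{12/19}` or
`|Δ(E)|^{19}·□(E)⁴ ≥ C·|E|^{20}`. -/
theorem distance_rectangle_lower_bound :
    ∃ C c : ℝ, 0 < C ∧ 0 < c ∧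
      ∀ (p : ℕ) [Fact p.Prime], p % 4 = 3 →
        ∀ E : Finset (Pt p), (E.card : ℝ) ≤ c * (p : ℝ) ^ ((8 : ℝ) / 5) →
          (((distSet E).card : ℝ) ≥ C * (E.card : ℝ) ^ ((12 : ℝ) / 19) ∨
            ((distSet E).card : ℝ) ^ (19 : ℕ) * (rectCount p E : ℝ) ^ (4 : ℕ) ≥
              C * (E.card : ℝ) ^ (20 : ℕ)) := by
  refine ⟨(10 ^ 80)⁻¹, 1, by positivity, one_pos, fun p _ hp E hE => ?_⟩
  rw [one_mul] at hE
  have hd : (0 : ℝ) ≤ (distSet E).card := by positivity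
  have hp1 : (1 : ℝ) ≤ p := by exact_mod_cast (Fact.out : p.Prime).one_le
  have hC {x y : ℝ} (h : y ≤ 10 ^ 80 * x) : x ≥ (10 ^ 80)⁻¹ * y :=
    (inv_mul_le_iff₀ (by positivity)).2 h
  have hD {y : ℝ} (h : y ≤ 10 ^ 5 * (distSet E).card) :
      ((distSet E).card : ℝ) ≥ (10 ^ 80)⁻¹ * y :=
    hC (h.trans (by gcongr <;> norm_num))
  rcases E.eq_empty_or_nonempty with rfl | hne
  · left
    rw [card_empty, Nat.cast_zero, Real.zero_rpow (by norm_num), mul_zero]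
    exact hd
  rcases exists_scale hp E hne with h | ⟨j, hj, h⟩
  · rcases lt_or_ge (E.card ^ 2) (4 * p ^ 3) with h4 | h4
    · left
      refine hD ((rpow_le_of_sq_lt (Nat.cast_nonneg _) hp1 (by exact_mod_cast h4)).trans ?_)
      linarith
    · right
      exact hC (pow_le_mul_of_scale_le (Nat.cast_nonneg _) hd hp1 hE h
        (rectCount_ge hp E h4))
  · left
    exact hD (rpow_le_of_sq_le hd (by exact_mod_cast hj) h)

end FpDist
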